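/- Let k,s ≥ 2 both be even and c ∈ {0,1}. Then an F-basis of the generalized Reynolds ideal T₁(A^{k,s}_c)^⊥ is given by 𝓝' ∪ {(αβγ)^i + (βγα)^i + (γαβ)^i : k/2 + 1 ≤ i ≤ k−1} ∪ {(αβγ)^k} ∪ {η^j : s/2 + 1 ≤ j ≤ s}, where 𝓝' = {η^{s/2} + (αβγ)^{k/2} + (βγα)^{k/2} + (γαβ)^{k/2}} if c = 0 and 𝓝' = {η^{s/2} + (αβγ)^{k/2} + (βγα)^{k/2} + (γαβ)^{k/2} + (βγα)^{k−1}βγ} if c = 1. -/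

import Mathlib

/- Common setup: the algebras D(2B)^{k,s}(c) of dihedral type, over a field F,
   presented as a quotient of the free algebra on the paths-generators
   e₁, e₂ (trivial paths), α (loop at vertex 1), β (arrow 1 → 2),
   γ (arrow 2 → 1), η (loop at vertex 2), by the path-algebra relations
   together with Erdmann's relations
   βη = 0, ηγ = 0, γβ = 0, α² = c(αβγ)^k, (αβγ)^k = (βγα)^k, η^s = (γαβ)^k. -/

noncomputable section

namespace DihedralPaper

inductive Gen : Type
  | e1 | e2 | a | b | g | h

variable (F : Type) [Field F]

/-- The generators inside the free algebra. -/
def gen (t : Gen) : FreeAlgebra F Gen := FreeAlgebra.ι F t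

/-- The defining relations of `D(2B)^{k,s}(c)` (paths written from left to right). -/
inductive Rel (k s : ℕ) (c : F) : FreeAlgebra F Gen → FreeAlgebra F Gen → Prop
  | unit : Rel k s c (gen F .e1 + gen F .e2) 1
  | idem1 : Rel k s c (gen F .e1 * gen F .e1) (gen F .e1)
  | idem2 : Rel k s c (gen F .e2 * gen F .e2) (gen F .e2)
  | orth12 : Rel k s c (gen F .e1 * gen F .e2) 0
  | orth21 : Rel k s c (gen F .e2 * gen F .e1) 0
  | aL : Rel k s c (gen F .e1 * gen F .a) (gen F .a)
  | aR : Rel k s c (gen F .a * gen F .e1) (gen F .a)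
  | bL : Rel k s c (gen F .e1 * gen F .b) (gen F .b)
  | bR : Rel k s c (gen F .b * gen F .e2) (gen F .b)
  | gL : Rel k s c (gen F .e2 * gen F .g) (gen F .g)
  | gR : Rel k s c (gen F .g * gen F .e1) (gen F .g)
  | hL : Rel k s c (gen F .e2 * gen F .h) (gen F .h)
  | hR : Rel k s c (gen F .h * gen F .e2) (gen F .h)
  | bh : Rel k s c (gen F .b * gen F .h) 0
  | hg : Rel k s c (gen F .h * gen F .g) 0
  | gb : Rel k s c (gen F .g * gen F .b) 0
  | asq : Rel k s c (gen F .a * gen F .a) (c • (gen F .a * gen F .b * gen F .g) ^ k)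
  | abg : Rel k s c ((gen F .a * gen F .b * gen F .g) ^ k) ((gen F .b * gen F .g * gen F .a) ^ k)
  | hs : Rel k s c ((gen F .h) ^ s) ((gen F .g * gen F .a * gen F .b) ^ k)

/-- The algebra `A^{k,s}_c = D(2B)^{k,s}(c)`. -/
def DA (k s : ℕ) (c : F) : Type := RingQuot (Rel F k s c)

instance (k s : ℕ) (c : F) : Ring (DA F k s c) :=
  inferInstanceAs (Ring (RingQuot (Rel F k s c)))

instance (k s : ℕ) (c : F) : Algebra F (DA F k s c) :=
  inferInstanceAs (Algebra F (RingQuot (Rel F k s c)))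

variable (k s : ℕ) (c : F)

/-- The canonical projection. -/
def mk : FreeAlgebra F Gen →ₐ[F] DA F k s c := RingQuot.mkAlgHom F (Rel F k s c)

def E1 : DA F k s c := mk F k s c (gen F .e1)
def E2 : DA F k s c := mk F k s c (gen F .e2)
/-- The image of the loop α at vertex 1. -/
def Al : DA F k s c := mk F k s c (gen F .a)
/-- The image of the arrow β : 1 → 2. -/
def Be : DA F k s c := mk F k s c (gen F .b)
/-- The image of the arrow γ : 2 → 1. -/
def Ga : DA F k s c := mk F k s c (gen F .g)
/-- The image of the loop η at vertex 2. -/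
def Et : DA F k s c := mk F k s c (gen F .h)

/-- The path αβγ. -/
def ABG : DA F k s c := Al F k s c * Be F k s c * Ga F k s c
/-- The path βγα. -/
def BGA : DA F k s c := Be F k s c * Ga F k s c * Al F k s c
/-- The path γαβ. -/
def GAB : DA F k s c := Ga F k s c * Al F k s c * Be F k s c

/-- The standard basis paths 𝓑₁₁ of e₁Ae₁. -/
def B11 : Set (DA F k s c) :=
  {E1 F k s c, Al F k s c, Be F k s c * Ga F k s c, (ABG F k s c) ^ k}
    ∪ (fun i => (ABG F k s c) ^ i) '' Set.Icc 1 (k - 1)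
    ∪ (fun i => (ABG F k s c) ^ i * Al F k s c) '' Set.Icc 1 (k - 1)
    ∪ (fun i => (BGA F k s c) ^ i) '' Set.Icc 1 (k - 1)
    ∪ (fun i => (BGA F k s c) ^ i * (Be F k s c * Ga F k s c)) '' Set.Icc 1 (k - 1)

/-- The standard basis paths 𝓑₁₂ of e₁Ae₂. -/
def B12 : Set (DA F k s c) :=
  {Be F k s c, Al F k s c * Be F k s c}
    ∪ (fun i => (BGA F k s c) ^ i * Be F k s c) '' Set.Icc 1 (k - 1)
    ∪ (fun i => (ABG F k s c) ^ i * (Al F k s c * Be F k s c)) '' Set.Icc 1 (k - 1)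

/-- The standard basis paths 𝓑₂₁ of e₂Ae₁. -/
def B21 : Set (DA F k s c) :=
  {Ga F k s c, Ga F k s c * Al F k s c}
    ∪ (fun i => (GAB F k s c) ^ i * Ga F k s c) '' Set.Icc 1 (k - 1)
    ∪ (fun i => (GAB F k s c) ^ i * (Ga F k s c * Al F k s c)) '' Set.Icc 1 (k - 1)

/-- The standard basis paths 𝓑₂₂ of e₂Ae₂. -/
def B22 : Set (DA F k s c) :=
  {E2 F k s c}
    ∪ (fun i => (GAB F k s c) ^ i) '' Set.Icc 1 (k - 1)
    ∪ (fun j => (Et F k s c) ^ j) '' Set.Icc 1 s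

/-- The standard path basis 𝓑 of `A^{k,s}_c`. -/
def BB : Set (DA F k s c) :=
  B11 F k s c ∪ B12 F k s c ∪ B21 F k s c ∪ B22 F k s c

/-- The commutator subspace K(A): the F-linear span of all commutators. -/
def Kspan (A : Type) [Ring A] [Algebra F A] : Submodule F A :=
  Submodule.span F {z : A | ∃ u v : A, z = u * v - v * u}

/-- The (left) socle of a ring: the sum of all simple (left) submodules. -/
def socle (A : Type) [Ring A] : Submodule A A := sSup {S : Submodule A A | IsAtom S}

/-- `ψ` is the linear form sending each standard basis path lying in the socle to 1
    and every other standard basis path to 0. -/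
def SoclePsi (ψ : DA F k s c →ₗ[F] F) : Prop :=
  ∀ p ∈ BB F k s c,
    (p ∈ socle (DA F k s c) → ψ p = 1) ∧ (p ∉ socle (DA F k s c) → ψ p = 0)

/-- `T₁(A) = {x : x² ∈ K(A)}`. -/
def T1set : Set (DA F k s c) := {z | z ^ 2 ∈ Kspan F (DA F k s c)}

/-- The orthogonal space `T₁(A)^⊥` with respect to the form `⟨x, y⟩ = ψ(xy)`. -/
def T1perp (ψ : DA F k s c →ₗ[F] F) : Set (DA F k s c) :=
  {y | ∀ x ∈ T1set F k s c, ψ (y * x) = 0}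

/-- The first generalized Reynolds ideal, as an ideal of the center `Z(A)`. -/
def ReynoldsIdeal (ψ : DA F k s c →ₗ[F] F) :
    Ideal (Subalgebra.center F (DA F k s c)) :=
  Ideal.span {z : Subalgebra.center F (DA F k s c) | (z : DA F k s c) ∈ T1perp F k s c ψ}


open Classical in
/-- The set 𝓝′ (case `k`, `s` both even). -/
def Np : Set (DA F k s c) :=
  if c = 0 then
    {(Et F k s c) ^ (s / 2) + (ABG F k s c) ^ (k / 2) + (BGA F k s c) ^ (k / 2)
       + (GAB F k s c) ^ (k / 2)}
  else
    {(Et F k s c) ^ (s / 2) + (ABG F k s c) ^ (k / 2) + (BGA F k s c) ^ (k / 2)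
       + (GAB F k s c) ^ (k / 2)
       + (BGA F k s c) ^ (k - 1) * (Be F k s c * Ga F k s c)}

/-- The claimed basis of `T₁(A^{k,s}_c)^⊥` (case `k`, `s` both even). -/
def TP : Set (DA F k s c) :=
  Np F k s c
    ∪ (fun i => (ABG F k s c) ^ i + (BGA F k s c) ^ i + (GAB F k s c) ^ i) ''
        Set.Icc (k / 2 + 1) (k - 1)
    ∪ {(ABG F k s c) ^ k}
    ∪ (fun j => (Et F k s c) ^ j) '' Set.Icc (s / 2 + 1) s

section Relations

set_option linter.unusedSectionVars false
set_option linter.unusedSimpArgs false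

local notation "ε₁" => E1 F k s c
local notation "ε₂" => E2 F k s c
local notation "α" => Al F k s c
local notation "β" => Be F k s c
local notation "γ" => Ga F k s c
local notation "η" => Et F k s c

theorem mk_eq_of_rel {x y : FreeAlgebra F Gen} (h : Rel F k s c x y) :
    mk F k s c x = mk F k s c y :=
  RingQuot.mkAlgHom_rel F h

theorem mk_surjective : Function.Surjective (mk F k s c) :=
  RingQuot.mkAlgHom_surjective F (Rel F k s c)

@[simp] theorem mk_gen_e1 : mk F k s c (gen F .e1) = ε₁ := rfl

@[simp] theorem mk_gen_e2 : mk F k s c (gen F .e2) = ε₂ := rfl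

@[simp] theorem mk_gen_a : mk F k s c (gen F .a) = α := rfl

@[simp] theorem mk_gen_b : mk F k s c (gen F .b) = β := rfl

@[simp] theorem mk_gen_g : mk F k s c (gen F .g) = γ := rfl

@[simp] theorem mk_gen_h : mk F k s c (gen F .h) = η := rfl

theorem E1_add_E2 : ε₁ + ε₂ = 1 := by
  simpa using mk_eq_of_rel F k s c Rel.unit

@[simp] theorem E1_mul_E1 : ε₁ * ε₁ = ε₁ := by
  simpa using mk_eq_of_rel F k s c Rel.idem1

@[simp] theorem E2_mul_E2 : ε₂ * ε₂ = ε₂ := by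
  simpa using mk_eq_of_rel F k s c Rel.idem2

@[simp] theorem E1_mul_E2 : ε₁ * ε₂ = 0 := by
  simpa using mk_eq_of_rel F k s c Rel.orth12

@[simp] theorem E2_mul_E1 : ε₂ * ε₁ = 0 := by
  simpa using mk_eq_of_rel F k s c Rel.orth21

@[simp] theorem E1_mul_Al : ε₁ * α = α := by
  simpa using mk_eq_of_rel F k s c Rel.aL

@[simp] theorem Al_mul_E1 : α * ε₁ = α := by
  simpa using mk_eq_of_rel F k s c Rel.aR

@[simp] theorem E1_mul_Be : ε₁ * β = β := by
  simpa using mk_eq_of_rel F k s c Rel.bL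

@[simp] theorem Be_mul_E2 : β * ε₂ = β := by
  simpa using mk_eq_of_rel F k s c Rel.bR

@[simp] theorem E2_mul_Ga : ε₂ * γ = γ := by
  simpa using mk_eq_of_rel F k s c Rel.gL

@[simp] theorem Ga_mul_E1 : γ * ε₁ = γ := by
  simpa using mk_eq_of_rel F k s c Rel.gR

@[simp] theorem E2_mul_Et : ε₂ * η = η := by
  simpa using mk_eq_of_rel F k s c Rel.hL

@[simp] theorem Et_mul_E2 : η * ε₂ = η := by
  simpa using mk_eq_of_rel F k s c Rel.hR

@[simp] theorem Be_mul_Et : β * η = 0 := by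
  simpa using mk_eq_of_rel F k s c Rel.bh

@[simp] theorem Et_mul_Ga : η * γ = 0 := by
  simpa using mk_eq_of_rel F k s c Rel.hg

@[simp] theorem Ga_mul_Be : γ * β = 0 := by
  simpa using mk_eq_of_rel F k s c Rel.gb

theorem mul_eq_zero_of_mul_eq_self {A : Type} [Ring A] {x y e f : A} (hx : x * e = x)
    (hy : f * y = y) (hef : e * f = 0) : x * y = 0 := by
  rw [← hx, ← hy, mul_assoc, ← mul_assoc e, hef, zero_mul, mul_zero]

@[simp] theorem E1_mul_Ga : ε₁ * γ = 0 :=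
  mul_eq_zero_of_mul_eq_self (E1_mul_E1 F k s c) (E2_mul_Ga F k s c) (E1_mul_E2 F k s c)

@[simp] theorem E1_mul_Et : ε₁ * η = 0 :=
  mul_eq_zero_of_mul_eq_self (E1_mul_E1 F k s c) (E2_mul_Et F k s c) (E1_mul_E2 F k s c)

@[simp] theorem E2_mul_Al : ε₂ * α = 0 :=
  mul_eq_zero_of_mul_eq_self (E2_mul_E2 F k s c) (E1_mul_Al F k s c) (E2_mul_E1 F k s c)

@[simp] theorem E2_mul_Be : ε₂ * β = 0 :=
  mul_eq_zero_of_mul_eq_self (E2_mul_E2 F k s c) (E1_mul_Be F k s c) (E2_mul_E1 F k s c)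

@[simp] theorem Al_mul_E2 : α * ε₂ = 0 :=
  mul_eq_zero_of_mul_eq_self (Al_mul_E1 F k s c) (E2_mul_E2 F k s c) (E1_mul_E2 F k s c)

@[simp] theorem Al_mul_Ga : α * γ = 0 :=
  mul_eq_zero_of_mul_eq_self (Al_mul_E1 F k s c) (E2_mul_Ga F k s c) (E1_mul_E2 F k s c)

@[simp] theorem Al_mul_Et : α * η = 0 :=
  mul_eq_zero_of_mul_eq_self (Al_mul_E1 F k s c) (E2_mul_Et F k s c) (E1_mul_E2 F k s c)

@[simp] theorem Be_mul_E1 : β * ε₁ = 0 :=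
  mul_eq_zero_of_mul_eq_self (Be_mul_E2 F k s c) (E1_mul_E1 F k s c) (E2_mul_E1 F k s c)

@[simp] theorem Be_mul_Al : β * α = 0 :=
  mul_eq_zero_of_mul_eq_self (Be_mul_E2 F k s c) (E1_mul_Al F k s c) (E2_mul_E1 F k s c)

@[simp] theorem Be_mul_Be : β * β = 0 :=
  mul_eq_zero_of_mul_eq_self (Be_mul_E2 F k s c) (E1_mul_Be F k s c) (E2_mul_E1 F k s c)

@[simp] theorem Ga_mul_E2 : γ * ε₂ = 0 :=
  mul_eq_zero_of_mul_eq_self (Ga_mul_E1 F k s c) (E2_mul_E2 F k s c) (E1_mul_E2 F k s c)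

@[simp] theorem Ga_mul_Ga : γ * γ = 0 :=
  mul_eq_zero_of_mul_eq_self (Ga_mul_E1 F k s c) (E2_mul_Ga F k s c) (E1_mul_E2 F k s c)

@[simp] theorem Ga_mul_Et : γ * η = 0 :=
  mul_eq_zero_of_mul_eq_self (Ga_mul_E1 F k s c) (E2_mul_Et F k s c) (E1_mul_E2 F k s c)

@[simp] theorem Et_mul_E1 : η * ε₁ = 0 :=
  mul_eq_zero_of_mul_eq_self (Et_mul_E2 F k s c) (E1_mul_E1 F k s c) (E2_mul_E1 F k s c)

@[simp] theorem Et_mul_Al : η * α = 0 :=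
  mul_eq_zero_of_mul_eq_self (Et_mul_E2 F k s c) (E1_mul_Al F k s c) (E2_mul_E1 F k s c)

@[simp] theorem Et_mul_Be : η * β = 0 :=
  mul_eq_zero_of_mul_eq_self (Et_mul_E2 F k s c) (E1_mul_Be F k s c) (E2_mul_E1 F k s c)

@[simp] theorem E1_mul_Ga_mul (x : DA F k s c) : ε₁ * (γ * x) = 0 := by
  rw [← mul_assoc, E1_mul_Ga, zero_mul]

@[simp] theorem E1_mul_Et_mul (x : DA F k s c) : ε₁ * (η * x) = 0 := by
  rw [← mul_assoc, E1_mul_Et, zero_mul]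

@[simp] theorem E2_mul_Al_mul (x : DA F k s c) : ε₂ * (α * x) = 0 := by
  rw [← mul_assoc, E2_mul_Al, zero_mul]

@[simp] theorem E2_mul_Be_mul (x : DA F k s c) : ε₂ * (β * x) = 0 := by
  rw [← mul_assoc, E2_mul_Be, zero_mul]

@[simp] theorem Al_mul_E2_mul (x : DA F k s c) : α * (ε₂ * x) = 0 := by
  rw [← mul_assoc, Al_mul_E2, zero_mul]

@[simp] theorem Al_mul_Ga_mul (x : DA F k s c) : α * (γ * x) = 0 := by
  rw [← mul_assoc, Al_mul_Ga, zero_mul]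

@[simp] theorem Al_mul_Et_mul (x : DA F k s c) : α * (η * x) = 0 := by
  rw [← mul_assoc, Al_mul_Et, zero_mul]

@[simp] theorem Be_mul_E1_mul (x : DA F k s c) : β * (ε₁ * x) = 0 := by
  rw [← mul_assoc, Be_mul_E1, zero_mul]

@[simp] theorem Be_mul_Al_mul (x : DA F k s c) : β * (α * x) = 0 := by
  rw [← mul_assoc, Be_mul_Al, zero_mul]

@[simp] theorem Be_mul_Be_mul (x : DA F k s c) : β * (β * x) = 0 := by
  rw [← mul_assoc, Be_mul_Be, zero_mul]

@[simp] theorem Ga_mul_E2_mul (x : DA F k s c) : γ * (ε₂ * x) = 0 := by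
  rw [← mul_assoc, Ga_mul_E2, zero_mul]

@[simp] theorem Ga_mul_Ga_mul (x : DA F k s c) : γ * (γ * x) = 0 := by
  rw [← mul_assoc, Ga_mul_Ga, zero_mul]

@[simp] theorem Ga_mul_Et_mul (x : DA F k s c) : γ * (η * x) = 0 := by
  rw [← mul_assoc, Ga_mul_Et, zero_mul]

@[simp] theorem Et_mul_E1_mul (x : DA F k s c) : η * (ε₁ * x) = 0 := by
  rw [← mul_assoc, Et_mul_E1, zero_mul]

@[simp] theorem Et_mul_Al_mul (x : DA F k s c) : η * (α * x) = 0 := by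
  rw [← mul_assoc, Et_mul_Al, zero_mul]

@[simp] theorem Et_mul_Be_mul (x : DA F k s c) : η * (β * x) = 0 := by
  rw [← mul_assoc, Et_mul_Be, zero_mul]

@[simp] theorem E1_mul_Al_mul (x : DA F k s c) : ε₁ * (α * x) = α * x := by
  rw [← mul_assoc, E1_mul_Al]

@[simp] theorem E1_mul_Be_mul (x : DA F k s c) : ε₁ * (β * x) = β * x := by
  rw [← mul_assoc, E1_mul_Be]

@[simp] theorem E2_mul_Ga_mul (x : DA F k s c) : ε₂ * (γ * x) = γ * x := by
  rw [← mul_assoc, E2_mul_Ga]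

@[simp] theorem E2_mul_Et_mul (x : DA F k s c) : ε₂ * (η * x) = η * x := by
  rw [← mul_assoc, E2_mul_Et]

@[simp] theorem Al_mul_E1_mul (x : DA F k s c) : α * (ε₁ * x) = α * x := by
  rw [← mul_assoc, Al_mul_E1]

@[simp] theorem Ga_mul_E1_mul (x : DA F k s c) : γ * (ε₁ * x) = γ * x := by
  rw [← mul_assoc, Ga_mul_E1]

@[simp] theorem Be_mul_E2_mul (x : DA F k s c) : β * (ε₂ * x) = β * x := by
  rw [← mul_assoc, Be_mul_E2]

@[simp] theorem Et_mul_E2_mul (x : DA F k s c) : η * (ε₂ * x) = η * x := by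
  rw [← mul_assoc, Et_mul_E2]

@[simp] theorem Be_mul_Et_mul (x : DA F k s c) : β * (η * x) = 0 := by
  rw [← mul_assoc, Be_mul_Et, zero_mul]

@[simp] theorem Et_mul_Ga_mul (x : DA F k s c) : η * (γ * x) = 0 := by
  rw [← mul_assoc, Et_mul_Ga, zero_mul]

@[simp] theorem Ga_mul_Be_mul (x : DA F k s c) : γ * (β * x) = 0 := by
  rw [← mul_assoc, Ga_mul_Be, zero_mul]

/-- The element αβγ + βγα + γαβ. -/
def cyc : DA F k s c := ABG F k s c + BGA F k s c + GAB F k s c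

theorem cyc_eq : cyc F k s c = α * (β * γ) + β * (γ * α) + γ * (α * β) := by
  simp only [cyc, ABG, BGA, GAB, mul_assoc]

theorem Al_mul_Al' : α * α = c • ABG F k s c ^ k := by
  simpa [ABG] using mk_eq_of_rel F k s c Rel.asq

theorem ABG_pow_eq_BGA_pow : ABG F k s c ^ k = BGA F k s c ^ k := by
  simpa [ABG, BGA] using mk_eq_of_rel F k s c Rel.abg

theorem Et_pow_eq_GAB_pow : η ^ s = GAB F k s c ^ k := by
  simpa [GAB] using mk_eq_of_rel F k s c Rel.hs

/-- Powers of the central element `cyc`. -/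
def cycPow (n : ℕ) : DA F k s c := cyc F k s c ^ n

local notation "τ" => cycPow F k s c

theorem cycPow_zero : τ 0 = 1 := pow_zero _

theorem cycPow_one : τ 1 = cyc F k s c := pow_one _

@[simp] theorem cycPow_mul (m n : ℕ) : τ m * τ n = τ (m + n) := (pow_add _ _ _).symm

@[simp] theorem cycPow_mul_mul (m n : ℕ) (x : DA F k s c) :
    τ m * (τ n * x) = τ (m + n) * x := by
  rw [← mul_assoc, cycPow_mul]

theorem cycPow_succ_left (n : ℕ) : τ (n + 1) = τ n * cyc F k s c := pow_succ _ _

@[simp] theorem Et_mul_cyc : η * cyc F k s c = 0 := by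
  simp [cyc_eq, mul_add, Et_mul_Ga_mul]

@[simp] theorem cyc_mul_Et : cyc F k s c * η = 0 := by
  simp [cyc_eq, add_mul, mul_assoc]

theorem Be_mul_cyc : β * cyc F k s c = β * (γ * (α * β)) := by
  simp [cyc_eq, mul_add]

theorem cyc_mul_Be : cyc F k s c * β = β * (γ * (α * β)) := by
  simp [cyc_eq, add_mul, mul_assoc]

theorem Ga_mul_cyc : γ * cyc F k s c = γ * (α * (β * γ)) := by
  simp [cyc_eq, mul_add]

theorem cyc_mul_Ga : cyc F k s c * γ = γ * (α * (β * γ)) := by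
  simp [cyc_eq, add_mul, mul_assoc]

theorem E1_mul_cyc : ε₁ * cyc F k s c = α * (β * γ) + β * (γ * α) := by
  simp [cyc_eq, mul_add]

theorem cyc_mul_E1 : cyc F k s c * ε₁ = α * (β * γ) + β * (γ * α) := by
  simp [cyc_eq, add_mul, mul_assoc]

theorem E2_mul_cyc : ε₂ * cyc F k s c = γ * (α * β) := by
  simp [cyc_eq, mul_add]

theorem cyc_mul_E2 : cyc F k s c * ε₂ = γ * (α * β) := by
  simp [cyc_eq, add_mul, mul_assoc]

variable [NeZero k]

theorem ABG_pow_mul_Be_mul_Ga : ABG F k s c ^ k * (β * γ) = 0 := by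
  obtain ⟨n, hn⟩ := Nat.exists_eq_succ_of_ne_zero (NeZero.ne k)
  rw [show ABG F k s c ^ k = ABG F k s c ^ (n + 1) by rw [hn], pow_succ, ABG]
  simp [mul_assoc]

@[simp] theorem Al_mul_Al_mul_Be_mul_Ga : α * (α * (β * γ)) = 0 := by
  rw [← mul_assoc, Al_mul_Al', smul_mul_assoc, ABG_pow_mul_Be_mul_Ga, smul_zero]

theorem Be_mul_Ga_mul_Al_mul_Al : β * (γ * (α * α)) = 0 := by
  obtain ⟨n, hn⟩ := Nat.exists_eq_succ_of_ne_zero (NeZero.ne k)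
  rw [Al_mul_Al', ABG_pow_eq_BGA_pow,
    show BGA F k s c ^ k = BGA F k s c ^ (n + 1) by rw [hn], pow_succ', BGA]
  simp [mul_assoc]

theorem ABG_mul_ABG : ABG F k s c * ABG F k s c = cyc F k s c * ABG F k s c := by
  simp [cyc_eq, ABG, add_mul, mul_assoc]

theorem ABG_pow_succ (n : ℕ) : ABG F k s c ^ (n + 1) = τ n * (α * (β * γ)) := by
  have h : α * (β * γ) = ABG F k s c := (mul_assoc _ _ _).symm
  rw [h]
  induction n with
  | zero => simp [cycPow_zero]
  | succ n ih =>
    rw [pow_succ, ih, cycPow_succ_left, mul_assoc, ABG_mul_ABG, mul_assoc]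

theorem Al_mul_cyc : α * cyc F k s c = α * (β * (γ * α)) := by
  simp [cyc_eq, mul_add]

theorem cyc_mul_Al : cyc F k s c * α = α * (β * (γ * α)) := by
  simp [cyc_eq, add_mul, mul_assoc, Be_mul_Ga_mul_Al_mul_Al]

@[simp] theorem Al_mul_cycPow (n : ℕ) : α * τ n = τ n * α :=
  ((show Commute α (cyc F k s c) from
    (Al_mul_cyc F k s c).trans (cyc_mul_Al F k s c).symm).pow_right n).eq

@[simp] theorem Al_mul_cycPow_mul (n : ℕ) (x : DA F k s c) : α * (τ n * x) = τ n * (α * x) := by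
  rw [← mul_assoc, Al_mul_cycPow, mul_assoc]

@[simp] theorem Be_mul_cycPow (n : ℕ) : β * τ n = τ n * β :=
  ((show Commute β (cyc F k s c) from
    (Be_mul_cyc F k s c).trans (cyc_mul_Be F k s c).symm).pow_right n).eq

@[simp] theorem Be_mul_cycPow_mul (n : ℕ) (x : DA F k s c) : β * (τ n * x) = τ n * (β * x) := by
  rw [← mul_assoc, Be_mul_cycPow, mul_assoc]

@[simp] theorem Ga_mul_cycPow (n : ℕ) : γ * τ n = τ n * γ :=
  ((show Commute γ (cyc F k s c) from
    (Ga_mul_cyc F k s c).trans (cyc_mul_Ga F k s c).symm).pow_right n).eq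

@[simp] theorem Ga_mul_cycPow_mul (n : ℕ) (x : DA F k s c) : γ * (τ n * x) = τ n * (γ * x) := by
  rw [← mul_assoc, Ga_mul_cycPow, mul_assoc]

@[simp] theorem E1_mul_cycPow (n : ℕ) : ε₁ * τ n = τ n * ε₁ :=
  ((show Commute ε₁ (cyc F k s c) from
    (E1_mul_cyc F k s c).trans (cyc_mul_E1 F k s c).symm).pow_right n).eq

@[simp] theorem E1_mul_cycPow_mul (n : ℕ) (x : DA F k s c) :
    ε₁ * (τ n * x) = τ n * (ε₁ * x) := by
  rw [← mul_assoc, E1_mul_cycPow, mul_assoc]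

@[simp] theorem E2_mul_cycPow (n : ℕ) : ε₂ * τ n = τ n * ε₂ :=
  ((show Commute ε₂ (cyc F k s c) from
    (E2_mul_cyc F k s c).trans (cyc_mul_E2 F k s c).symm).pow_right n).eq

@[simp] theorem E2_mul_cycPow_mul (n : ℕ) (x : DA F k s c) :
    ε₂ * (τ n * x) = τ n * (ε₂ * x) := by
  rw [← mul_assoc, E2_mul_cycPow, mul_assoc]

theorem commute_Et_cyc : Commute η (cyc F k s c) :=
  (Et_mul_cyc F k s c).trans (cyc_mul_Et F k s c).symm

@[simp] theorem Et_mul_cycPow (n : ℕ) : η * τ n = τ n * η :=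
  ((commute_Et_cyc F k s c).pow_right n).eq

@[simp] theorem Et_pow_mul_cycPow (m n : ℕ) : η ^ m * τ n = τ n * η ^ m :=
  ((commute_Et_cyc F k s c).pow_pow m n).eq

@[simp] theorem Et_mul_cycPow_mul (n : ℕ) (x : DA F k s c) :
    η * (τ n * x) = τ n * (η * x) := by
  rw [← mul_assoc, Et_mul_cycPow, mul_assoc]

@[simp] theorem Et_pow_mul_cycPow_mul (m n : ℕ) (x : DA F k s c) :
    η ^ m * (τ n * x) = τ n * (η ^ m * x) := by
  rw [← mul_assoc, Et_pow_mul_cycPow, mul_assoc]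

@[simp] theorem cycPow_mul_Et {n : ℕ} (hn : n ≠ 0) : τ n * η = 0 := by
  obtain ⟨n, rfl⟩ := Nat.exists_eq_succ_of_ne_zero hn
  rw [Nat.succ_eq_add_one, cycPow_succ_left, mul_assoc, cyc_mul_Et, mul_zero]

@[simp] theorem cycPow_mul_Et_pow {n m : ℕ} (hn : n ≠ 0) (hm : m ≠ 0) : τ n * η ^ m = 0 := by
  obtain ⟨m, rfl⟩ := Nat.exists_eq_succ_of_ne_zero hm
  rw [pow_succ', ← mul_assoc, cycPow_mul_Et F k s c hn, zero_mul]

@[simp] theorem Be_mul_Ga_mul_Al_mul_Be : β * (γ * (α * β)) = τ 1 * β := by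
  rw [cycPow_one, cyc_mul_Be]

@[simp] theorem Be_mul_Ga_mul_Al_mul_Be_mul (x : DA F k s c) :
    β * (γ * (α * (β * x))) = τ 1 * (β * x) := by
  simp only [← mul_assoc, cycPow_one, cyc_mul_Be]

@[simp] theorem Ga_mul_Al_mul_Be_mul_Ga : γ * (α * (β * γ)) = τ 1 * γ := by
  rw [cycPow_one, cyc_mul_Ga]

@[simp] theorem Ga_mul_Al_mul_Be_mul_Ga_mul (x : DA F k s c) :
    γ * (α * (β * (γ * x))) = τ 1 * (γ * x) := by
  simp only [← mul_assoc, cycPow_one, cyc_mul_Ga]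

theorem BGA_mul_BGA : BGA F k s c * BGA F k s c = cyc F k s c * BGA F k s c := by
  simp [cyc_eq, BGA, add_mul, mul_assoc]

theorem BGA_pow_succ (n : ℕ) : BGA F k s c ^ (n + 1) = τ n * (β * (γ * α)) := by
  have h : β * (γ * α) = BGA F k s c := (mul_assoc _ _ _).symm
  rw [h]
  induction n with
  | zero => simp [cycPow_zero]
  | succ n ih =>
    rw [pow_succ, ih, cycPow_succ_left, mul_assoc, BGA_mul_BGA, mul_assoc]

theorem GAB_mul_GAB : GAB F k s c * GAB F k s c = cyc F k s c * GAB F k s c := by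
  simp [cyc_eq, GAB, add_mul, mul_assoc]

theorem GAB_pow_succ (n : ℕ) : GAB F k s c ^ (n + 1) = τ n * (γ * (α * β)) := by
  have h : γ * (α * β) = GAB F k s c := (mul_assoc _ _ _).symm
  rw [h]
  induction n with
  | zero => simp [cycPow_zero]
  | succ n ih =>
    rw [pow_succ, ih, cycPow_succ_left, mul_assoc, GAB_mul_GAB, mul_assoc]

@[simp] theorem Al_mul_Be_mul_Ga_mul_Al : α * (β * (γ * α)) = τ 1 * α := by
  rw [cycPow_one, cyc_mul_Al]

@[simp] theorem Al_mul_Be_mul_Ga_mul_Al_mul (x : DA F k s c) :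
    α * (β * (γ * (α * x))) = τ 1 * (α * x) := by
  simp only [← mul_assoc, cycPow_one, cyc_mul_Al]

theorem ABG_pow_card : ABG F k s c ^ k = τ (k - 1) * (α * (β * γ)) := by
  rw [← ABG_pow_succ, Nat.sub_add_cancel NeZero.one_le]

@[simp] theorem cycPow_mul_Be_mul_Ga_mul_Al :
    τ (k - 1) * (β * (γ * α)) = τ (k - 1) * (α * (β * γ)) := by
  rw [← ABG_pow_succ, ← BGA_pow_succ, Nat.sub_add_cancel NeZero.one_le, ABG_pow_eq_BGA_pow]

theorem Et_pow_card : η ^ s = τ (k - 1) * (γ * (α * β)) := by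
  rw [← GAB_pow_succ, Nat.sub_add_cancel NeZero.one_le, Et_pow_eq_GAB_pow]

@[simp] theorem Al_mul_Al : α * α = c • (τ (k - 1) * (α * (β * γ))) := by
  rw [Al_mul_Al', ABG_pow_card]

@[simp] theorem Al_mul_Al_mul (x : DA F k s c) :
    α * (α * x) = c • (τ (k - 1) * (α * (β * (γ * x)))) := by
  rw [← mul_assoc, Al_mul_Al, smul_mul_assoc]
  simp only [mul_assoc]

theorem cycPow_card_mul_Be : τ k * β = 0 := by
  have h : τ k * β = τ (k - 1) * (β * (γ * α)) * β := by
    simp [mul_assoc, -cycPow_mul_Be_mul_Ga_mul_Al, Nat.sub_add_cancel NeZero.one_le]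
  rw [h, cycPow_mul_Be_mul_Ga_mul_Al]
  simp [mul_assoc]

theorem cycPow_card_mul_Ga : τ k * γ = 0 := by
  have h : τ k * γ = γ * (τ (k - 1) * (α * (β * γ))) := by
    simp [Nat.sub_add_cancel NeZero.one_le]
  rw [h, ← cycPow_mul_Be_mul_Ga_mul_Al, Ga_mul_cycPow_mul, Ga_mul_Be_mul, mul_zero]

theorem cycPow_card_mul_Al : τ k * α = 0 := by
  have h : τ k * α = τ (k - 1) * (α * (β * γ)) * α := by
    simp [mul_assoc, Nat.sub_add_cancel NeZero.one_le]
  rw [h, ← cycPow_mul_Be_mul_Ga_mul_Al, mul_assoc, mul_assoc, mul_assoc,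
    Be_mul_Ga_mul_Al_mul_Al, mul_zero]

theorem cycPow_mul_eq_zero_of_le {n : ℕ} (hn : k ≤ n) {x : DA F k s c} (hx : τ k * x = 0) :
    τ n * x = 0 := by
  rw [← Nat.sub_add_cancel hn, ← cycPow_mul, mul_assoc, hx, mul_zero]

@[simp] theorem cycPow_mul_Al {n : ℕ} (hn : k ≤ n) : τ n * α = 0 :=
  cycPow_mul_eq_zero_of_le F k s c hn (cycPow_card_mul_Al F k s c)

@[simp] theorem cycPow_mul_Be {n : ℕ} (hn : k ≤ n) : τ n * β = 0 :=
  cycPow_mul_eq_zero_of_le F k s c hn (cycPow_card_mul_Be F k s c)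

@[simp] theorem cycPow_mul_Ga {n : ℕ} (hn : k ≤ n) : τ n * γ = 0 :=
  cycPow_mul_eq_zero_of_le F k s c hn (cycPow_card_mul_Ga F k s c)

@[simp] theorem cycPow_mul_Al_mul {n : ℕ} (hn : k ≤ n) (x : DA F k s c) : τ n * (α * x) = 0 := by
  rw [← mul_assoc, cycPow_mul_Al F k s c hn, zero_mul]

@[simp] theorem cycPow_mul_Be_mul {n : ℕ} (hn : k ≤ n) (x : DA F k s c) : τ n * (β * x) = 0 := by
  rw [← mul_assoc, cycPow_mul_Be F k s c hn, zero_mul]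

@[simp] theorem cycPow_mul_Ga_mul {n : ℕ} (hn : k ≤ n) (x : DA F k s c) : τ n * (γ * x) = 0 := by
  rw [← mul_assoc, cycPow_mul_Ga F k s c hn, zero_mul]

theorem cycPow_mul_E1 {n : ℕ} (hn : n ≠ 0) :
    τ n * ε₁ = τ (n - 1) * (α * (β * γ)) + τ (n - 1) * (β * (γ * α)) := by
  obtain ⟨n, rfl⟩ := Nat.exists_eq_succ_of_ne_zero hn
  rw [Nat.succ_eq_add_one, cycPow_succ_left, mul_assoc, cyc_mul_E1, mul_add, Nat.add_sub_cancel]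

theorem cycPow_mul_E2 {n : ℕ} (hn : n ≠ 0) : τ n * ε₂ = τ (n - 1) * (γ * (α * β)) := by
  obtain ⟨n, rfl⟩ := Nat.exists_eq_succ_of_ne_zero hn
  rw [Nat.succ_eq_add_one, cycPow_succ_left, mul_assoc, cyc_mul_E2, Nat.add_sub_cancel]

section EtaPowers

variable {n : ℕ}

theorem Et_pow_ne_zero_eq (hn : n ≠ 0) : η ^ n = η * η ^ (n - 1) ∧ η ^ n = η ^ (n - 1) * η := by
  obtain ⟨n, rfl⟩ := Nat.exists_eq_succ_of_ne_zero hn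
  exact ⟨pow_succ' _ _, pow_succ _ _⟩

@[simp] theorem E1_mul_Et_pow (hn : n ≠ 0) : ε₁ * η ^ n = 0 := by
  rw [(Et_pow_ne_zero_eq F k s c hn).1, E1_mul_Et_mul]

@[simp] theorem E2_mul_Et_pow (hn : n ≠ 0) : ε₂ * η ^ n = η ^ n := by
  rw [(Et_pow_ne_zero_eq F k s c hn).1, E2_mul_Et_mul]

@[simp] theorem Al_mul_Et_pow (hn : n ≠ 0) : α * η ^ n = 0 := by
  rw [(Et_pow_ne_zero_eq F k s c hn).1, Al_mul_Et_mul]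

@[simp] theorem Be_mul_Et_pow (hn : n ≠ 0) : β * η ^ n = 0 := by
  rw [(Et_pow_ne_zero_eq F k s c hn).1, Be_mul_Et_mul]

@[simp] theorem Ga_mul_Et_pow (hn : n ≠ 0) : γ * η ^ n = 0 := by
  rw [(Et_pow_ne_zero_eq F k s c hn).1, Ga_mul_Et_mul]

@[simp] theorem Et_pow_mul_E1 (hn : n ≠ 0) : η ^ n * ε₁ = 0 := by
  rw [(Et_pow_ne_zero_eq F k s c hn).2, mul_assoc, Et_mul_E1, mul_zero]

@[simp] theorem Et_pow_mul_E2 (hn : n ≠ 0) : η ^ n * ε₂ = η ^ n := by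
  rw [(Et_pow_ne_zero_eq F k s c hn).2, mul_assoc, Et_mul_E2]

@[simp] theorem Et_pow_mul_Al (hn : n ≠ 0) : η ^ n * α = 0 := by
  rw [(Et_pow_ne_zero_eq F k s c hn).2, mul_assoc, Et_mul_Al, mul_zero]

@[simp] theorem Et_pow_mul_Be (hn : n ≠ 0) : η ^ n * β = 0 := by
  rw [(Et_pow_ne_zero_eq F k s c hn).2, mul_assoc, Et_mul_Be, mul_zero]

@[simp] theorem Et_pow_mul_Ga (hn : n ≠ 0) : η ^ n * γ = 0 := by
  rw [(Et_pow_ne_zero_eq F k s c hn).2, mul_assoc, Et_mul_Ga, mul_zero]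

@[simp] theorem Et_pow_mul_Al_mul (hn : n ≠ 0) (x : DA F k s c) : η ^ n * (α * x) = 0 := by
  rw [← mul_assoc, Et_pow_mul_Al F k s c hn, zero_mul]

@[simp] theorem Et_pow_mul_Be_mul (hn : n ≠ 0) (x : DA F k s c) : η ^ n * (β * x) = 0 := by
  rw [← mul_assoc, Et_pow_mul_Be F k s c hn, zero_mul]

@[simp] theorem Et_pow_mul_Ga_mul (hn : n ≠ 0) (x : DA F k s c) : η ^ n * (γ * x) = 0 := by
  rw [← mul_assoc, Et_pow_mul_Ga F k s c hn, zero_mul]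

theorem Et_mul_Et_pow (n : ℕ) : η * η ^ n = η ^ (n + 1) := (pow_succ' _ _).symm

theorem Et_pow_mul_Et (n : ℕ) : η ^ n * η = η ^ (n + 1) := (pow_succ _ _).symm

theorem Et_pow_mul_Et_pow (m n : ℕ) : η ^ m * η ^ n = η ^ (m + n) := (pow_add _ _ _).symm

theorem Et_pow_eq_zero (hn : s < n) : η ^ n = 0 := by
  have h : η ^ (s + 1) = 0 := by
    rw [pow_succ, Et_pow_card, mul_assoc, mul_assoc, mul_assoc, Be_mul_Et]
    simp
  exact pow_eq_zero_of_le hn h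

end EtaPowers

section Paths

/-- Names for the paths spanning `DA F k s c`. -/
inductive Pth : Type
  | e1 | e2 | h (n : ℕ) | a (n : ℕ) | b (n : ℕ) | g (n : ℕ) | ab (n : ℕ) | bg (n : ℕ) | ga (n : ℕ)
  | abg (n : ℕ) | bga (n : ℕ) | gab (n : ℕ)

/-- The path with a given name, written as a power of `cyc` times a short path. -/
def Pth.val : Pth → DA F k s c
  | .e1 => ε₁
  | .e2 => ε₂
  | .h n => η ^ (n + 1)
  | .a n => τ n * α
  | .b n => τ n * β
  | .g n => τ n * γ
  | .ab n => τ n * (α * β)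
  | .bg n => τ n * (β * γ)
  | .ga n => τ n * (γ * α)
  | .abg n => τ n * (α * (β * γ))
  | .bga n => τ n * (β * (γ * α))
  | .gab n => τ n * (γ * (α * β))

theorem induction_gen {P : DA F k s c → Prop} (h1 : P ε₁) (h2 : P ε₂) (ha : P α) (hb : P β)
    (hg : P γ) (hh : P η) (hone : P 1) (hsmul : ∀ (r : F) x, P x → P (r • x))
    (hadd : ∀ x y, P x → P y → P (x + y)) (hmul : ∀ x y, P x → P y → P (x * y))
    (x : DA F k s c) : P x := by
  obtain ⟨x, rfl⟩ := mk_surjective F k s c x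
  induction x with
  | grade0 r =>
    rw [AlgHom.commutes, Algebra.algebraMap_eq_smul_one]
    exact hsmul _ _ hone
  | grade1 t => cases t <;> assumption
  | mul x y hx hy => rw [map_mul]; exact hmul _ _ hx hy
  | add x y hx hy => rw [map_add]; exact hadd _ _ hx hy

theorem span_val : Submodule.span F (Set.range (Pth.val F k s c)) = ⊤ := by
  obtain ⟨V, hV⟩ : ∃ V, V = Submodule.span F (Set.range (Pth.val F k s c)) := ⟨_, rfl⟩
  rw [← hV]
  have hval (p : Pth) : p.val F k s c ∈ V := hV ▸ Submodule.subset_span ⟨p, rfl⟩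
  have hτ {x : DA F k s c} (hx : ∀ n, τ n * x ∈ V) : (∀ n, τ n * x ∈ V) ∧ x ∈ V :=
    ⟨hx, by simpa [cycPow_zero] using hx 0⟩
  have h1 : ε₁ ∈ V := hval .e1
  have h2 : ε₂ ∈ V := hval .e2
  have hh (n : ℕ) : η ^ (n + 1) ∈ V := hval (.h n)
  have hh0 : η ∈ V := by simpa using hh 0
  have ha := hτ fun n => hval (.a n)
  have hb := hτ fun n => hval (.b n)
  have hg := hτ fun n => hval (.g n)
  have hab := hτ fun n => hval (.ab n)
  have hbg := hτ fun n => hval (.bg n)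
  have hga := hτ fun n => hval (.ga n)
  have habg := hτ fun n => hval (.abg n)
  have hbga := hτ fun n => hval (.bga n)
  have hgab := hτ fun n => hval (.gab n)
  have hone : (1 : DA F k s c) ∈ V := by
    rw [← E1_add_E2]
    exact V.add_mem h1 h2
  have hgen {x : DA F k s c} (hx : ∀ p : Pth, x * p.val F k s c ∈ V) :
      V ≤ V.comap (LinearMap.mulLeft F x) := by
    conv_lhs => rw [hV]
    rw [Submodule.span_le]
    rintro _ ⟨p, rfl⟩
    exact hx p
  clear hval hτ
  have hmul (x : DA F k s c) : V ≤ V.comap (LinearMap.mulLeft F x) := by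
    induction x using induction_gen with
    | h1 => refine hgen fun p => ?_; cases p <;> simp [Pth.val, Et_mul_Et_pow, V.smul_mem,
        h1, h2, hh, hh0, ha, hb, hg, hab, hbg, hga, habg, hbga, hgab]
    | h2 => refine hgen fun p => ?_; cases p <;> simp [Pth.val, Et_mul_Et_pow, V.smul_mem,
        h1, h2, hh, hh0, ha, hb, hg, hab, hbg, hga, habg, hbga, hgab]
    | ha => refine hgen fun p => ?_; cases p <;> simp [Pth.val, Et_mul_Et_pow, V.smul_mem,
        h1, h2, hh, hh0, ha, hb, hg, hab, hbg, hga, habg, hbga, hgab]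
    | hb => refine hgen fun p => ?_; cases p <;> simp [Pth.val, Et_mul_Et_pow, V.smul_mem,
        h1, h2, hh, hh0, ha, hb, hg, hab, hbg, hga, habg, hbga, hgab]
    | hg => refine hgen fun p => ?_; cases p <;> simp [Pth.val, Et_mul_Et_pow, V.smul_mem,
        h1, h2, hh, hh0, ha, hb, hg, hab, hbg, hga, habg, hbga, hgab]
    | hh => refine hgen fun p => ?_; cases p <;> simp [Pth.val, Et_mul_Et_pow, V.smul_mem,
        h1, h2, hh, hh0, ha, hb, hg, hab, hbg, hga, habg, hbga, hgab]
    | hone => intro y hy; simpa using hy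
    | hsmul r x hx => intro y hy; simpa using V.smul_mem r (hx hy)
    | hadd x y hx hy => intro z hz; simpa [add_mul] using V.add_mem (hx hz) (hy hz)
    | hmul x y hx hy => intro z hz; simpa [mul_assoc] using hx (hy hz)
  rw [eq_top_iff]
  intro x _
  simpa using hmul x hone

/-- A property of elements closed under linear combinations may be checked on paths. -/
theorem forall_of_val (V : Submodule F (DA F k s c)) (hV : ∀ p : Pth, p.val F k s c ∈ V)
    (x : DA F k s c) : x ∈ V := by
  have h : Submodule.span F (Set.range (Pth.val F k s c)) ≤ V :=
    Submodule.span_le.2 (Set.range_subset_iff.2 hV)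
  exact h (span_val F k s c ▸ Submodule.mem_top)

theorem commute_of_gen {z : DA F k s c} (h1 : Commute z ε₁) (h2 : Commute z ε₂)
    (ha : Commute z α) (hb : Commute z β) (hg : Commute z γ) (hh : Commute z η)
    (x : DA F k s c) : Commute z x :=
  induction_gen F k s c h1 h2 ha hb hg hh (Commute.one_right z)
    (fun r _ hx => hx.smul_right r) (fun _ _ hx hy => hx.add_right hy)
    (fun _ _ hx hy => hx.mul_right hy) x

theorem commute_cycPow (n : ℕ) (x : DA F k s c) : Commute (τ n) x :=
  commute_of_gen F k s c (E1_mul_cycPow F k s c n).symm (E2_mul_cycPow F k s c n).symm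
    (Al_mul_cycPow F k s c n).symm (Be_mul_cycPow F k s c n).symm (Ga_mul_cycPow F k s c n).symm
    (Et_mul_cycPow F k s c n).symm x

theorem commute_Et (x : DA F k s c) : Commute η x := by
  apply commute_of_gen <;> simp [Commute, SemiconjBy]

theorem cyc_isNilpotent : IsNilpotent (cyc F k s c) := by
  refine ⟨k + 1, ?_⟩
  change τ (k + 1) = 0
  rw [cycPow_succ_left, cyc_eq]
  simp [mul_add]

end Paths

section Socle

/-- The left ideal of elements annihilated by all arrows. -/
def arrowAnn : Submodule (DA F k s c) (DA F k s c) where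
  carrier := {x | α * x = 0 ∧ β * x = 0 ∧ γ * x = 0 ∧ η * x = 0}
  zero_mem' := by simp
  add_mem' := by
    rintro x y ⟨_, _, _, _⟩ ⟨_, _, _, _⟩
    simp_all [mul_add]
  smul_mem' r := by
    induction r using induction_gen with
    | h1 => rintro x ⟨_, _, _, _⟩; simp_all
    | h2 => rintro x ⟨_, _, _, _⟩; simp_all
    | ha => rintro x ⟨_, _, _, _⟩; simp_all
    | hb => rintro x ⟨_, _, _, _⟩; simp_all
    | hg => rintro x ⟨_, _, _, _⟩; simp_all
    | hh => rintro x ⟨_, _, _, _⟩; simp_all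
    | hone => intro x hx; simpa using hx
    | hsmul r y hy =>
      intro x hx
      have := hy hx
      simp_all
    | hadd y z hy hz =>
      intro x hx
      have := hy hx
      have := hz hx
      simp_all [add_mul, mul_add]
    | hmul y z hy hz => intro x hx; simpa [mul_assoc] using hy (hz hx)

theorem mul_eq_zero_of_isAtom {A : Type} [Ring A] {S : Submodule A A} (hS : IsAtom S) {z : A}
    (hz : ∀ x, Commute z x) (hnil : IsNilpotent z) {x : A} (hx : x ∈ S) : z * x = 0 := by
  let L : A →ₗ[A] A :=
    { toFun := fun x => z * x
      map_add' := mul_add z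
      map_smul' := fun a x => by
        simp only [smul_eq_mul, RingHom.id_apply, ← mul_assoc, (hz a).eq] }
  by_contra hzx
  have hbot : S ⊓ LinearMap.ker L = ⊥ := by
    refine (hS.le_iff.1 inf_le_left).resolve_right fun h => hzx ?_
    exact (h.ge hx).2
  have hinj {y : A} (hy : y ∈ S) (hy0 : z * y = 0) : y = 0 :=
    (Submodule.mem_bot A).1 (hbot ▸ (⟨hy, hy0⟩ : y ∈ S ⊓ LinearMap.ker L))
  have hpow (n : ℕ) : z ^ n * x = 0 → x = 0 := by
    induction n with
    | zero => simp
    | succ n ih =>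
      intro h
      rw [pow_succ', mul_assoc] at h
      exact ih (hinj (S.smul_mem _ hx) h)
  obtain ⟨n, hn⟩ := hnil
  exact hzx (by rw [hpow n (by rw [hn, zero_mul]), mul_zero])

theorem Et_isNilpotent : IsNilpotent η :=
  ⟨s + 1, Et_pow_eq_zero F k s c (Nat.lt_succ_self s)⟩

variable {F k s c} in
theorem isAtom_le_arrowAnn (hk : 2 ≤ k) {S : Submodule (DA F k s c) (DA F k s c)}
    (hS : IsAtom S) : S ≤ arrowAnn F k s c := by
  have hη {x : DA F k s c} (hx : x ∈ S) : η * x = 0 :=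
    mul_eq_zero_of_isAtom hS (commute_Et F k s c) (Et_isNilpotent F k s c) hx
  have hτ {x : DA F k s c} (hx : x ∈ S) {n : ℕ} (hn : n ≠ 0) : τ n * x = 0 := by
    refine mul_eq_zero_of_isAtom hS (commute_cycPow F k s c n) ?_ hx
    exact (cyc_isNilpotent F k s c).pow_of_pos hn
  have hmem {x y : DA F k s c} (hx : x ∈ S) : y * x ∈ S := S.smul_mem y hx
  have hαα {x : DA F k s c} (hx : x ∈ S) : α * (α * x) = 0 := by
    rw [Al_mul_Al_mul, hτ (hmem (hmem (hmem hx))) (by omega), smul_zero]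
  have hne : ∃ x ∈ S, x ≠ 0 := S.ne_bot_iff.1 hS.1
  refine (hS.le_iff.1 inf_le_left : S ⊓ arrowAnn F k s c = ⊥ ∨ _).elim (fun hbot => ?_)
    fun h => inf_eq_left.1 h
  exfalso
  let arrows : Set (DA F k s c) := {α, β, γ, η}
  have hinj {x : DA F k s c} (hx : x ∈ S) (h : ∀ a ∈ arrows, a * x = 0) : x = 0 := by
    refine (Submodule.mem_bot (DA F k s c)).1 (hbot ▸ ⟨hx, ?_⟩)
    exact ⟨h _ (by simp [arrows]), h _ (by simp [arrows]), h _ (by simp [arrows]),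
      h _ (by simp [arrows])⟩
  have h4 {x : DA F k s c} (hx : x ∈ S) :
      ∀ a ∈ arrows, ∀ b ∈ arrows, ∀ d ∈ arrows, ∀ e ∈ arrows, a * (b * (d * (e * x))) = 0 := by
    have h0 := hη hx
    have h1 := hαα hx
    have h2 := hαα (hmem (y := β) hx)
    have h3 := hαα (hmem (y := β) (hmem (y := γ) hx))
    have h4 := hτ (hmem (y := α) hx) one_ne_zero
    have h5 := hτ (hmem (y := β) hx) one_ne_zero
    have h6 := hτ (hmem (y := γ) hx) one_ne_zero
    simp only [arrows, Set.mem_insert_iff, Set.mem_singleton_iff]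
    rintro _ (rfl | rfl | rfl | rfl) _ (rfl | rfl | rfl | rfl) _ (rfl | rfl | rfl | rfl)
      _ (rfl | rfl | rfl | rfl) <;>
    simp only [Al_mul_Et_mul, Al_mul_Ga_mul, Be_mul_Al_mul, Be_mul_Be_mul, Be_mul_Et_mul,
      Ga_mul_Be_mul, Ga_mul_Ga_mul, Ga_mul_Et_mul, Et_mul_Al_mul, Et_mul_Be_mul, Et_mul_Ga_mul,
      Al_mul_Be_mul_Ga_mul_Al_mul, Be_mul_Ga_mul_Al_mul_Be_mul, Ga_mul_Al_mul_Be_mul_Ga_mul,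
      h0, h1, h2, h3, h4, h5, h6, mul_zero]
  obtain ⟨x, hx, hx0⟩ := hne
  refine hx0 (hinj hx fun a ha => hinj (hmem hx) fun b hb => hinj (hmem (hmem hx)) fun d hd =>
    hinj (hmem (hmem (hmem hx))) fun e he => ?_)
  exact h4 hx e he d hd b hb a ha

theorem socle_le_arrowAnn (hk : 2 ≤ k) : socle (DA F k s c) ≤ arrowAnn F k s c :=
  sSup_le fun _ hS => isAtom_le_arrowAnn hk hS

end Socle

section PathPowers

variable (n : ℕ)

theorem ABG_pow_mul_Al : ABG F k s c ^ n * α = τ n * α := by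
  cases n <;> simp [ABG_pow_succ, cycPow_zero, mul_assoc]

theorem ABG_pow_mul_Al_mul_Be : ABG F k s c ^ n * (α * β) = τ n * (α * β) := by
  rw [← mul_assoc, ABG_pow_mul_Al, mul_assoc]

theorem BGA_pow_mul_Be : BGA F k s c ^ n * β = τ n * β := by
  cases n <;> simp [BGA_pow_succ, cycPow_zero, mul_assoc]

theorem BGA_pow_mul_Be_mul_Ga : BGA F k s c ^ n * (β * γ) = τ n * (β * γ) := by
  rw [← mul_assoc, BGA_pow_mul_Be, mul_assoc]

theorem GAB_pow_mul_Ga : GAB F k s c ^ n * γ = τ n * γ := by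
  cases n <;> simp [GAB_pow_succ, cycPow_zero, mul_assoc]

theorem GAB_pow_mul_Ga_mul_Al : GAB F k s c ^ n * (γ * α) = τ n * (γ * α) := by
  rw [← mul_assoc, GAB_pow_mul_Ga, mul_assoc]

end PathPowers

section Form

theorem mem_socle_of_forall_smul {z : DA F k s c} (hz : ∀ x, ∃ r : F, x * z = r • z) :
    z ∈ socle (DA F k s c) := by
  by_cases h0 : z = 0
  · rw [h0]; exact Submodule.zero_mem _
  refine (le_sSup (?_ : IsAtom (Submodule.span (DA F k s c) {z})) : _ ≤ socle (DA F k s c))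
    (Submodule.mem_span_singleton_self z)
  refine ⟨fun h => h0 (Submodule.span_singleton_eq_bot.1 h), fun T hT => ?_⟩
  by_contra hne
  obtain ⟨t, ht, ht0⟩ := T.ne_bot_iff.1 hne
  obtain ⟨x, hx⟩ := Submodule.mem_span_singleton.1 (hT.le ht)
  obtain ⟨r, hr⟩ := hz x
  rw [smul_eq_mul, hr] at hx
  have hr0 : r ≠ 0 := by
    rintro rfl
    exact ht0 (by rw [← hx, zero_smul])
  refine hT.not_ge ((Submodule.span_singleton_le_iff_mem z T).2 ?_)
  have : z = algebraMap F (DA F k s c) r⁻¹ * t := by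
    rw [← hx, ← Algebra.smul_def, smul_smul, inv_mul_cancel₀ hr0, one_smul]
  rw [this]
  exact T.smul_mem _ ht

theorem mem_socle_of_gen {z : DA F k s c} (h1 : ∃ r : F, ε₁ * z = r • z)
    (h2 : ∃ r : F, ε₂ * z = r • z) (ha : α * z = 0) (hb : β * z = 0) (hg : γ * z = 0)
    (hh : η * z = 0) : z ∈ socle (DA F k s c) := by
  refine mem_socle_of_forall_smul F k s c fun x => ?_
  refine induction_gen F k s c (P := fun x => ∃ r : F, x * z = r • z) h1 h2
    ⟨0, by simpa using ha⟩ ⟨0, by simpa using hb⟩ ⟨0, by simpa using hg⟩ ⟨0, by simpa using hh⟩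
    ⟨1, by simp⟩ ?_ ?_ ?_ x
  · rintro r x ⟨t, ht⟩
    exact ⟨r * t, by rw [smul_mul_assoc, ht, smul_smul]⟩
  · rintro x y ⟨t, ht⟩ ⟨u, hu⟩
    exact ⟨t + u, by rw [add_mul, ht, hu, add_smul]⟩
  · rintro x y ⟨t, ht⟩ ⟨u, hu⟩
    exact ⟨u * t, by rw [mul_assoc, hu, mul_smul_comm, ht, smul_smul]⟩

/-- The values of the symmetrizing form on paths. -/
structure PathForm (ψ : DA F k s c →ₗ[F] F) : Prop where
  e1 : ψ ε₁ = 0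
  e2 : ψ ε₂ = 0
  a (n : ℕ) : ψ (τ n * α) = 0
  b (n : ℕ) : ψ (τ n * β) = 0
  g (n : ℕ) : ψ (τ n * γ) = 0
  ab (n : ℕ) : ψ (τ n * (α * β)) = 0
  bg (n : ℕ) : ψ (τ n * (β * γ)) = 0
  ga (n : ℕ) : ψ (τ n * (γ * α)) = 0
  abg (n : ℕ) : ψ (τ n * (α * (β * γ))) = if n + 1 = k then 1 else 0
  bga (n : ℕ) : ψ (τ n * (β * (γ * α))) = if n + 1 = k then 1 else 0
  gab (n : ℕ) : ψ (τ n * (γ * (α * β))) = if n + 1 = k then 1 else 0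
  h (n : ℕ) (hn : n ≠ 0) : ψ (η ^ n) = if n = s then 1 else 0

variable {F k s c} in
theorem SoclePsi.pathForm {ψ : DA F k s c →ₗ[F] F} (hψ : SoclePsi F k s c ψ) (hk : 2 ≤ k)
    (hs : 2 ≤ s) : PathForm F k s c ψ := by
  have hk1 : k - 1 + 1 = k := by omega
  have hkk : k ≤ 1 + (k - 1) := by omega
  have hkk' : k ≤ k - 1 + 1 := by omega
  have hz1 : ψ (τ (k - 1) * (α * (β * γ))) = 1 := by
    refine (hψ _ ?_).1 (mem_socle_of_gen F k s c ⟨1, by simp⟩ ⟨0, by simp⟩ ?_ ?_ ?_ ?_)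
    · rw [← ABG_pow_card]
      exact .inl (.inl (.inl (by simp [B11])))
    all_goals simp [hkk, hkk']
  have hz2 : ψ (η ^ s) = 1 := by
    have hs0 : s ≠ 0 := by omega
    refine (hψ _ ?_).1 (mem_socle_of_gen F k s c ⟨0, by simp [hs0]⟩ ⟨1, by simp [hs0]⟩ ?_ ?_ ?_ ?_)
    · exact .inr (.inr ⟨s, ⟨by omega, le_rfl⟩, rfl⟩)
    iterate 3 simp [hs0]
    rw [Et_mul_Et_pow, Et_pow_eq_zero F k s c (by omega)]
  have hz2' : ψ (τ (k - 1) * (γ * (α * β))) = 1 := by rw [← Et_pow_card, hz2]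
  have key {p : DA F k s c} (hp : p ∈ BB F k s c)
      (h : ∃ x y, ψ (x * (α * p) * y) = 1 ∨ ψ (x * (β * p) * y) = 1 ∨ ψ (x * (γ * p) * y) = 1 ∨
        ψ (x * (η * p) * y) = 1) : ψ p = 0 := by
    refine (hψ p hp).2 fun hsoc => ?_
    obtain ⟨ha, hb, hg, hh⟩ := socle_le_arrowAnn F k s c hk hsoc
    obtain ⟨x, y, h⟩ := h
    simp [ha, hb, hg, hh] at h
  have hB11 {x : DA F k s c} (hx : x ∈ B11 F k s c) : x ∈ BB F k s c := .inl (.inl (.inl hx))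
  have hB12 {x : DA F k s c} (hx : x ∈ B12 F k s c) : x ∈ BB F k s c := .inl (.inl (.inr hx))
  have hB21 {x : DA F k s c} (hx : x ∈ B21 F k s c) : x ∈ BB F k s c := .inl (.inr hx)
  have hB22 {x : DA F k s c} (hx : x ∈ B22 F k s c) : x ∈ BB F k s c := .inr hx
  refine ⟨?_, ?_, fun n => ?_, fun n => ?_, fun n => ?_, fun n => ?_, fun n => ?_, fun n => ?_,
    fun n => ?_, fun n => ?_, fun n => ?_, fun n hn => ?_⟩
  · exact key (hB11 (by simp [B11])) ⟨τ (k - 1), α * β, .inr (.inr (.inl (by simpa [mul_assoc])))⟩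
  · exact key (hB22 (by simp [B22])) ⟨1, η ^ (s - 1), .inr (.inr (.inr (by
      simpa [Et_mul_Et_pow, show s - 1 + 1 = s by omega])))⟩
  · obtain h | h := le_or_gt k n
    · simp [h]
    refine key (hB11 ?_) ⟨τ (k - 1 - n), β, .inr (.inr (.inl ?_))⟩
    · obtain rfl | hn := Nat.eq_zero_or_pos n
      · simp [B11, cycPow_zero]
      · rw [← ABG_pow_mul_Al]
        exact .inl <| .inl <| .inr ⟨n, ⟨hn, by omega⟩, rfl⟩
    · simpa [mul_assoc, show k - 1 - n + n = k - 1 by omega]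
  · obtain h | h := le_or_gt k n
    · simp [h]
    refine key (hB12 ?_) ⟨τ (k - 1 - n), γ, .inl ?_⟩
    · obtain rfl | hn := Nat.eq_zero_or_pos n
      · simp [B12, cycPow_zero]
      · rw [← BGA_pow_mul_Be]
        exact .inl <| .inr ⟨n, ⟨hn, by omega⟩, rfl⟩
    · simpa [mul_assoc, show k - 1 - n + n = k - 1 by omega]
  · obtain h | h := le_or_gt k n
    · simp [h]
    refine key (hB21 ?_) ⟨τ (k - 1 - n), α, .inr (.inl ?_)⟩
    · obtain rfl | hn := Nat.eq_zero_or_pos n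
      · simp [B21, cycPow_zero]
      · rw [← GAB_pow_mul_Ga]
        exact .inl <| .inr ⟨n, ⟨hn, by omega⟩, rfl⟩
    · simpa [mul_assoc, show k - 1 - n + n = k - 1 by omega]
  · obtain h | h := le_or_gt k n
    · simp [h]
    refine key (hB12 ?_) ⟨τ (k - 1 - n), 1, .inr (.inr (.inl ?_))⟩
    · obtain rfl | hn := Nat.eq_zero_or_pos n
      · simp [B12, cycPow_zero]
      · rw [← ABG_pow_mul_Al_mul_Be]
        exact .inr ⟨n, ⟨hn, by omega⟩, rfl⟩
    · simpa [mul_assoc, show k - 1 - n + n = k - 1 by omega]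
  · obtain h | h := le_or_gt k n
    · simp [h]
    refine key (hB11 ?_) ⟨τ (k - 1 - n), 1, .inl ?_⟩
    · obtain rfl | hn := Nat.eq_zero_or_pos n
      · simp [B11, cycPow_zero]
      · rw [← BGA_pow_mul_Be_mul_Ga]
        exact .inr ⟨n, ⟨hn, by omega⟩, rfl⟩
    · simpa [mul_assoc, show k - 1 - n + n = k - 1 by omega]
  · obtain h | h := le_or_gt k n
    · simp [h]
    refine key (hB21 ?_) ⟨τ (k - 1 - n), 1, .inr (.inl ?_)⟩
    · obtain rfl | hn := Nat.eq_zero_or_pos n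
      · simp [B21, cycPow_zero]
      · rw [← GAB_pow_mul_Ga_mul_Al]
        exact .inr ⟨n, ⟨hn, by omega⟩, rfl⟩
    · simpa [mul_assoc, show k - 1 - n + n = k - 1 by omega]
  · obtain h | h | h := lt_trichotomy (n + 1) k
    · rw [if_neg h.ne]
      refine key (hB11 ?_) ⟨τ (k - 2 - n), α * β, .inr (.inr (.inl ?_))⟩
      · rw [← ABG_pow_succ]
        exact .inl <| .inl <| .inl <| .inr ⟨n + 1, ⟨by omega, by omega⟩, rfl⟩
      · simpa [mul_assoc, show k - 2 - n + (n + 1) = k - 1 by omega]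
    · rw [if_pos h, show n = k - 1 by omega]
      simpa
    · rw [if_neg h.ne']
      simp [show k ≤ n by omega]
  · obtain h | h | h := lt_trichotomy (n + 1) k
    · rw [if_neg h.ne]
      refine key (hB11 ?_) ⟨τ (k - 2 - n), β * γ, .inl ?_⟩
      · rw [← BGA_pow_succ]
        exact .inl <| .inr ⟨n + 1, ⟨by omega, by omega⟩, rfl⟩
      · simpa [mul_assoc, show k - 2 - n + (n + 1) = k - 1 by omega]
    · rw [if_pos h, show n = k - 1 by omega]
      simpa
    · rw [if_neg h.ne']
      simp [show k ≤ n by omega]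
  · obtain h | h | h := lt_trichotomy (n + 1) k
    · rw [if_neg h.ne]
      refine key (hB22 ?_) ⟨τ (k - 2 - n), γ * α, .inr (.inl ?_)⟩
      · rw [← GAB_pow_succ]
        exact .inl <| .inr ⟨n + 1, ⟨by omega, by omega⟩, rfl⟩
      · simpa [mul_assoc, show k - 2 - n + (n + 1) = k - 1 by omega]
    · rw [if_pos h, show n = k - 1 by omega]
      simpa
    · rw [if_neg h.ne']
      simp [show k ≤ n by omega]
  · obtain h | rfl | h := lt_trichotomy n s
    · rw [if_neg h.ne]
      refine key (hB22 (.inr ⟨n, ⟨by omega, h.le⟩, rfl⟩))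
        ⟨1, η ^ (s - 1 - n), .inr (.inr (.inr ?_))⟩
      rw [one_mul, Et_mul_Et_pow, Et_pow_mul_Et_pow, show n + 1 + (s - 1 - n) = s by omega, hz2]
    · rw [if_pos rfl, hz2]
    · rw [if_neg h.ne', Et_pow_eq_zero F k s c h, map_zero]

end Form

namespace PathForm

variable {F k s c} {ψ : DA F k s c →ₗ[F] F}

theorem values (hf : PathForm F k s c ψ) :
    ψ ε₁ = 0 ∧ ψ ε₂ = 0 ∧ (ψ α = 0 ∧ ∀ n, ψ (τ n * α) = 0) ∧
    (ψ β = 0 ∧ ∀ n, ψ (τ n * β) = 0) ∧ (ψ γ = 0 ∧ ∀ n, ψ (τ n * γ) = 0) ∧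
    (ψ (α * β) = 0 ∧ ∀ n, ψ (τ n * (α * β)) = 0) ∧
    (ψ (β * γ) = 0 ∧ ∀ n, ψ (τ n * (β * γ)) = 0) ∧
    (ψ (γ * α) = 0 ∧ ∀ n, ψ (τ n * (γ * α)) = 0) ∧
    (ψ (α * (β * γ)) = if 0 + 1 = k then 1 else 0) ∧
    (∀ n, ψ (τ n * (α * (β * γ))) = if n + 1 = k then 1 else 0) ∧
    (ψ (β * (γ * α)) = if 0 + 1 = k then 1 else 0) ∧
    (∀ n, ψ (τ n * (β * (γ * α))) = if n + 1 = k then 1 else 0) ∧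
    (ψ (γ * (α * β)) = if 0 + 1 = k then 1 else 0) ∧
    (∀ n, ψ (τ n * (γ * (α * β))) = if n + 1 = k then 1 else 0) ∧
    ∀ n ≠ 0, ψ (η ^ n) = if n = s then 1 else 0 := by
  have h0 (x : DA F k s c) : x = τ 0 * x := by rw [cycPow_zero, one_mul]
  refine ⟨hf.e1, hf.e2, ⟨?_, hf.a⟩, ⟨?_, hf.b⟩, ⟨?_, hf.g⟩, ⟨?_, hf.ab⟩, ⟨?_, hf.bg⟩, ⟨?_, hf.ga⟩,
    ?_, hf.abg, ?_, hf.bga, ?_, hf.gab, hf.h⟩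
  · rw [h0 α, hf.a]
  · rw [h0 β, hf.b]
  · rw [h0 γ, hf.g]
  · rw [h0 (α * β), hf.ab]
  · rw [h0 (β * γ), hf.bg]
  · rw [h0 (γ * α), hf.ga]
  · rw [h0 (α * (β * γ)), hf.abg]
  · rw [h0 (β * (γ * α)), hf.bga]
  · rw [h0 (γ * (α * β)), hf.gab]

theorem symm_of_gen {x : DA F k s c}
    (h : ∀ p : Pth, ψ (x * p.val F k s c) = ψ (p.val F k s c * x)) (y : DA F k s c) :
    ψ (x * y) = ψ (y * x) := by
  have := forall_of_val F k s c (LinearMap.ker (ψ ∘ₗ LinearMap.mulLeft F x -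
    ψ ∘ₗ LinearMap.mulRight F x)) (fun p => by simp [h p]) y
  simpa [sub_eq_zero] using this

theorem symm (hf : PathForm F k s c ψ) (x y : DA F k s c) : ψ (x * y) = ψ (y * x) := by
  revert y
  induction x using induction_gen with
  | hone => simp
  | hsmul r x hx => intro y; simp [hx y]
  | hadd x y hx hy => intro z; simp [add_mul, mul_add, hx z, hy z]
  | hmul x y hx hy => intro z; rw [mul_assoc, hx, mul_assoc, hy, mul_assoc]
  | _ =>
    refine symm_of_gen fun p => ?_
    cases p <;> simp [Pth.val, mul_assoc, hf.values, Et_mul_Et_pow, Et_pow_mul_Et]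

end PathForm

section Nondegenerate

/-- The indices of the paths which form a basis of `DA F k s c`. -/
def Pth.Valid : Pth → Prop
  | .e1 | .e2 => True
  | .h n => n < s
  | .a n | .b n | .g n | .ab n | .bg n | .ga n | .abg n => n < k
  | .bga n | .gab n => n + 1 < k

/-- The basis dual to `Pth.val` with respect to the symmetrizing form. -/
def Pth.dual : Pth → DA F k s c
  | .e1 => τ (k - 1) * (α * (β * γ))
  | .e2 => η ^ s
  | .h n => if n + 1 = s then ε₂ else η ^ (s - 1 - n)
  | .a n => τ (k - 1 - n) * (β * γ)
  | .b n => τ (k - 1 - n) * (γ * α)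
  | .g n => τ (k - 1 - n) * (α * β)
  | .ab n => τ (k - 1 - n) * γ
  | .bg n => τ (k - 1 - n) * (α - c • (τ (k - 1) * (β * γ)))
  | .ga n => τ (k - 1 - n) * β
  | .abg n => if n + 1 = k then ε₁ else τ (k - 2 - n) * (α * (β * γ))
  | .bga n => τ (k - 2 - n) * (β * (γ * α))
  | .gab n => τ (k - 2 - n) * (γ * (α * β))

variable {F k s c} in
theorem PathForm.val_dual {ψ : DA F k s c →ₗ[F] F} (hf : PathForm F k s c ψ) (hk : 2 ≤ k)
    (hs : 2 ≤ s) {u w : Pth} (hu : u.Valid k s) (hw : w.Valid k s) :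
    (u = w → ψ (u.val F k s c * w.dual F k s c) = 1) ∧
    (u ≠ w → ψ (u.val F k s c * w.dual F k s c) = 0) := by
  have hs0 : s ≠ 0 := by omega
  rcases u with _ | _ | n | n | n | n | n | n | n | n | n | n <;>
  rcases w with _ | _ | m | m | m | m | m | m | m | m | m | m <;>
  simp only [Pth.Valid] at hu hw <;>
  simp [Pth.val, Pth.dual, mul_assoc, mul_sub, mul_ite, apply_ite ψ, hf.values, Et_mul_Et_pow,
    Et_pow_mul_Et, Et_pow_mul_Et_pow, hs0, Nat.add_assoc] <;>
  first
  | omega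
  | (have hm : ¬m + 1 = s → s - 1 - m ≠ 0 := by omega
     intro h; simp [hm h, hf.h _ (hm h)]; done)
  | (have hm : ¬m + 1 = s → s - 1 - m ≠ 0 := by omega
     intro h; simp [hm h, hf.h _ (hm h)]; omega)
  | (have hm : ¬m + 1 = s → s - 1 - m ≠ 0 := by omega
     split_ifs with h <;> first | omega | rfl | simp [hm h])
  | (split_ifs <;> simp <;> omega)

variable {F k s c} in
/-- The symmetrizing form is non-degenerate. -/
theorem PathForm.eq_zero_of_forall {ψ : DA F k s c →ₗ[F] F} (hf : PathForm F k s c ψ) (hk : 2 ≤ k)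
    (hs : 2 ≤ s) {y : DA F k s c} (hy : ∀ x, ψ (y * x) = 0) : y = 0 := by
  classical
  let v : {p : Pth // p.Valid k s} → DA F k s c := fun p => p.1.val F k s c
  have hv (p : {p : Pth // p.Valid k s}) : p.1.val F k s c ∈ Submodule.span F (Set.range v) :=
    Submodule.subset_span ⟨p, rfl⟩
  have hmem : y ∈ Submodule.span F (Set.range v) := by
    refine forall_of_val F k s c _ (fun p => ?_) y
    by_cases hp : p.Valid k s
    · exact hv ⟨p, hp⟩
    have h0 : p.val F k s c = 0 ∨ p.val F k s c = τ (k - 1) * (α * (β * γ)) ∨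
        p.val F k s c = η ^ s := by
      cases p with
      | e1 | e2 => exact absurd trivial hp
      | h n => exact .inl (Et_pow_eq_zero F k s c (by simp only [Pth.Valid] at hp; omega))
      | bga n =>
        obtain hn | hn : n = k - 1 ∨ k ≤ n := by simp only [Pth.Valid] at hp; omega
        · exact .inr (.inl (by simp [Pth.val, hn]))
        · exact .inl (by simp [Pth.val, hn])
      | gab n =>
        obtain hn | hn : n = k - 1 ∨ k ≤ n := by simp only [Pth.Valid] at hp; omega
        · exact .inr (.inr (by simp [Pth.val, hn, Et_pow_card]))
        · exact .inl (by simp [Pth.val, hn])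
      | _ n =>
        exact .inl (by simp [Pth.val, not_lt.1 hp])
    obtain h | h | h := h0
    · rw [h]; exact Submodule.zero_mem _
    · rw [h]; exact hv ⟨.abg (k - 1), by simp only [Pth.Valid]; omega⟩
    · have := hv ⟨.h (s - 1), by simp only [Pth.Valid]; omega⟩
      rwa [Pth.val, Nat.sub_add_cancel (by omega), ← h] at this
  obtain ⟨a, rfl⟩ := (Finsupp.mem_span_range_iff_exists_finsupp).1 hmem
  have ha : a = 0 := by
    ext w
    have := hy (w.1.dual F k s c)
    rw [Finsupp.sum_mul, map_finsuppSum, Finsupp.sum_eq_single w] at this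
    · simpa [v, (hf.val_dual hk hs w.2 w.2).1 rfl] using this
    · intro u _ huw
      simp [v, (hf.val_dual hk hs u.2 w.2).2 fun h => huw (Subtype.ext h)]
    · simp
  simp [ha]

end Nondegenerate

section Reynolds

variable {F k s c}

theorem ABG_pow_add_BGA_pow_add_GAB_pow {i : ℕ} (hi : i ≠ 0) :
    ABG F k s c ^ i + BGA F k s c ^ i + GAB F k s c ^ i = τ i := by
  obtain ⟨n, rfl⟩ := Nat.exists_eq_succ_of_ne_zero hi
  rw [Nat.succ_eq_add_one, ABG_pow_succ, BGA_pow_succ, GAB_pow_succ, cycPow_succ_left, cyc_eq,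
    mul_add, mul_add]

variable [CharP F 2] {ψ : DA F k s c →ₗ[F] F}

theorem PathForm.sq_eq (hf : PathForm F k s c ψ) {t z : DA F k s c} (hz : ∀ x, Commute z x)
    (h : ∀ p : Pth, ψ (t * p.val F k s c) ^ 2 = ψ (z * (p.val F k s c * p.val F k s c)))
    (x : DA F k s c) : ψ (t * x) ^ 2 = ψ (z * (x * x)) := by
  refine forall_of_val F k s c
    { carrier := {x | ψ (t * x) ^ 2 = ψ (z * (x * x))}
      zero_mem' := by simp
      add_mem' := ?_
      smul_mem' := ?_ } h x
  · intro x y (hx : ψ (t * x) ^ 2 = ψ (z * (x * x))) (hy : ψ (t * y) ^ 2 = ψ (z * (y * y)))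
    have hxy : ψ (z * (y * x)) = ψ (z * (x * y)) := by
      rw [← mul_assoc, hf.symm, ← mul_assoc, ← (hz x).eq, mul_assoc]
    change ψ (t * (x + y)) ^ 2 = ψ (z * ((x + y) * (x + y)))
    simp only [mul_add, add_mul, map_add, hxy, CharTwo.add_sq, hx, hy]
    linear_combination (-ψ (z * (x * y))) * CharTwo.two_eq_zero (R := F)
  · intro r x (hx : ψ (t * x) ^ 2 = ψ (z * (x * x)))
    change ψ (t * r • x) ^ 2 = ψ (z * ((r • x) * (r • x)))
    simp only [mul_smul_comm, smul_mul_assoc, map_smul, smul_eq_mul, mul_pow, hx]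
    ring

theorem PathForm.mem_T1perp (hf : PathForm F k s c ψ) {t z : DA F k s c} (hz : ∀ x, Commute z x)
    (h : ∀ p : Pth, ψ (t * p.val F k s c) ^ 2 = ψ (z * (p.val F k s c * p.val F k s c))) :
    t ∈ T1perp F k s c ψ := by
  intro x (hx : x ^ 2 ∈ Kspan F (DA F k s c))
  have hK : Kspan F (DA F k s c) ≤ LinearMap.ker (ψ ∘ₗ LinearMap.mulLeft F z) := by
    refine Submodule.span_le.2 ?_
    rintro _ ⟨u, v, rfl⟩
    have : ψ (z * (v * u)) = ψ (z * (u * v)) := by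
      rw [← mul_assoc, hf.symm, ← mul_assoc, ← (hz u).eq, mul_assoc]
    simp [mul_sub, this]
  have := hK hx
  rw [LinearMap.mem_ker, LinearMap.comp_apply, LinearMap.mulLeft_apply, sq,
    ← hf.sq_eq hz h] at this
  exact pow_eq_zero_iff two_ne_zero |>.1 this

theorem PathForm.cycPow_mem_T1perp (hf : PathForm F k s c ψ) {i : ℕ} (hi : k / 2 < i)
    (hik : i < k) (hkev : Even k) : τ i ∈ T1perp F k s c ψ := by
  obtain ⟨m, hm⟩ := hkev
  have hi0 : i ≠ 0 := by omega
  have hi' : 2 * i - k ≠ 0 := by omega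
  refine hf.mem_T1perp (commute_cycPow F k s c (2 * i - k)) fun p => ?_
  cases p <;> simp [Pth.val, mul_assoc, hf.values, Et_pow_mul_Et_pow,
    cycPow_mul_E1, cycPow_mul_E2, hi0, hi'] <;>
    first | (intro h; omega) | (split_ifs <;> first | omega | simp)

theorem PathForm.Et_pow_mem_T1perp (hf : PathForm F k s c ψ) {j : ℕ} (hj : s / 2 < j)
    (hsev : Even s) : η ^ j ∈ T1perp F k s c ψ := by
  obtain ⟨m, hm⟩ := hsev
  have hj0 : j ≠ 0 := by omega
  have hj' : 2 * j - s ≠ 0 := by omega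
  refine hf.mem_T1perp (z := η ^ (2 * j - s)) (fun x => (commute_Et F k s c x).pow_left _)
    fun p => ?_
  cases p <;> simp [Pth.val, mul_assoc, hf.values, Et_pow_mul_Et_pow, hj0, hj'] <;>
    split_ifs <;> first | omega | simp

theorem PathForm.ABG_pow_mem_T1perp (hf : PathForm F k s c ψ) (hk : 2 ≤ k) :
    ABG F k s c ^ k ∈ T1perp F k s c ψ := by
  rw [ABG_pow_card]
  refine hf.mem_T1perp (z := τ (k - 1) * (α * (β * γ))) ?_ fun p => ?_
  · apply commute_of_gen <;> simp [Commute, SemiconjBy, mul_assoc, show k ≤ k - 1 + 1 by omega]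
  cases p <;> simp [Pth.val, mul_assoc, hf.values, Et_pow_mul_Et_pow] <;>
    first | (intro h; omega) | (split_ifs <;> first | omega | simp)

theorem PathForm.middle_mem_T1perp (hf : PathForm F k s c ψ) (hk : 2 ≤ k) (hkev : Even k)
    (hs : 2 ≤ s) (hsev : Even s) (hc : c = 0 ∨ c = 1) :
    η ^ (s / 2) + τ (k / 2) + c • (τ (k - 1) * (β * γ)) ∈ T1perp F k s c ψ := by
  obtain ⟨m, hm⟩ := hsev
  obtain ⟨l, hl⟩ := hkev
  have hc2 : c ^ 2 = c := by obtain rfl | rfl := hc <;> simp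
  have hs' : s / 2 ≠ 0 := by omega
  have hk' : k / 2 ≠ 0 := by omega
  refine hf.mem_T1perp (Commute.one_left) fun p => ?_
  cases p <;> simp [Pth.val, mul_assoc, add_mul, hf.values, Et_pow_mul_Et_pow,
    cycPow_mul_E1, cycPow_mul_E2, hs', hk'] <;>
    split_ifs <;> first | omega | simp [hc2]

end Reynolds

section T1

variable [CharP F 2]

theorem add_self_eq_zero_of_charTwo (x : DA F k s c) : x + x = 0 := by
  rw [← two_smul F x, CharTwo.two_eq_zero, zero_smul]

theorem add_mem_Kspan (x y : DA F k s c) : x * y + y * x ∈ Kspan F (DA F k s c) := by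
  have h : x * y + y * x = x * y - y * x := by
    rw [sub_eq_add_neg, neg_eq_of_add_eq_zero_right (add_self_eq_zero_of_charTwo F k s c _)]
  rw [h]
  exact Submodule.subset_span ⟨x, y, rfl⟩

/-- `T1set` as a subspace. -/
def T1 : Submodule F (DA F k s c) where
  carrier := T1set F k s c
  zero_mem' := by simp [T1set]
  add_mem' := by
    intro x y (hx : x ^ 2 ∈ Kspan F (DA F k s c)) (hy : y ^ 2 ∈ Kspan F (DA F k s c))
    have h : (x + y) ^ 2 = x ^ 2 + y ^ 2 + (x * y + y * x) := by
      simp only [sq, mul_add, add_mul]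
      abel
    change (x + y) ^ 2 ∈ Kspan F (DA F k s c)
    rw [h]
    exact Submodule.add_mem _ (Submodule.add_mem _ hx hy) (add_mem_Kspan F k s c x y)
  smul_mem' := by
    intro r x (hx : x ^ 2 ∈ Kspan F (DA F k s c))
    change (r • x) ^ 2 ∈ Kspan F (DA F k s c)
    rw [smul_pow]
    exact Submodule.smul_mem _ _ hx

variable {F k s c}

theorem mem_T1 {x : DA F k s c} : x ∈ T1 F k s c ↔ x * x ∈ Kspan F (DA F k s c) := by
  rw [← sq]; rfl

theorem mem_T1_of_mul_self {x : DA F k s c} (h : x * x = 0) : x ∈ T1 F k s c := by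
  rw [mem_T1, h]
  exact Submodule.zero_mem _

theorem ABG_add_GAB_mem_Kspan (n : ℕ) :
    τ n * (α * (β * γ)) + τ n * (γ * (α * β)) ∈ Kspan F (DA F k s c) := by
  simpa [mul_assoc] using add_mem_Kspan F k s c (τ n * (α * β)) γ

theorem BGA_add_GAB_mem_Kspan (n : ℕ) :
    τ n * (β * (γ * α)) + τ n * (γ * (α * β)) ∈ Kspan F (DA F k s c) := by
  simpa [mul_assoc] using add_mem_Kspan F k s c (τ n * β) (γ * α)

theorem eq_top_of_T1_le {M : Submodule F (DA F k s c)} (hM : T1 F k s c ≤ M) (hk : 2 ≤ k)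
    (hkev : Even k) (hs : 2 ≤ s) (hsev : Even s) (hc : c = 0 ∨ c = 1) (h1 : ε₁ ∈ M) (h2 : ε₂ ∈ M)
    (hh : ∀ n, n + 1 ≤ s / 2 → η ^ (n + 1) ∈ M)
    (hgab : ∀ n, n + 1 < k / 2 → τ n * (γ * (α * β)) ∈ M) : M = ⊤ := by
  obtain ⟨l, hl⟩ := hkev
  obtain ⟨m, hm⟩ := hsev
  have hs2 : s / 2 ≠ 0 := by omega
  have hss : s / 2 + s / 2 = s := by omega
  have hηs : η ^ (s / 2) ∈ M := by
    simpa [show s / 2 - 1 + 1 = s / 2 by omega] using hh (s / 2 - 1) (by omega)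
  have hzero {x : DA F k s c} (h : x * x = 0) : x ∈ M := hM (mem_T1_of_mul_self h)
  have hadd {x y : DA F k s c} (hy : y ∈ M) (h : (x + y) * (x + y) ∈ Kspan F (DA F k s c)) :
      x ∈ M := (Submodule.add_mem_iff_left _ hy).1 (hM (mem_T1.2 h))
  have hgab' (n : ℕ) : τ n * (γ * (α * β)) ∈ M := by
    obtain h | h | h := lt_trichotomy (n + 1) (k / 2)
    · exact hgab n h
    · refine hadd hηs ?_
      have : n + (n + 1) = k - 1 := by omega
      simp [mul_add, add_mul, mul_assoc, hs2, Et_pow_mul_Et_pow, hss, this, Et_pow_card,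
        add_self_eq_zero_of_charTwo]
    · exact hzero (by simp [mul_assoc, show k ≤ n + (n + 1) by omega])
  rw [eq_top_iff]
  rintro x -
  refine forall_of_val F k s c M (fun p => ?_) x
  cases p with
  | e1 => exact h1
  | e2 => exact h2
  | h n =>
    obtain h | h := le_or_gt (n + 1) (s / 2)
    · exact hh n h
    · refine hzero ?_
      rw [Pth.val, Et_pow_mul_Et_pow, Et_pow_eq_zero F k s c (by omega)]
  | a n =>
    obtain rfl | hn := Nat.eq_zero_or_pos n
    · refine hadd (M.smul_mem c hηs) ?_
      have hc2 : c * c = c := by obtain rfl | rfl := hc <;> simp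
      have h := (Kspan F (DA F k s c)).smul_mem c (ABG_add_GAB_mem_Kspan (k - 1))
      simpa [Pth.val, cycPow_zero, mul_add, add_mul, hs2, Et_pow_mul_Et_pow, hss, smul_smul, hc2,
        Et_pow_card] using h
    · exact hzero (by simp [Pth.val, mul_assoc, show k ≤ n + (n + (k - 1)) by omega])
  | gab n => exact hgab' n
  | abg n =>
    refine hadd (hgab' n) ?_
    simpa [Pth.val, mul_add, add_mul, mul_assoc] using ABG_add_GAB_mem_Kspan (n + (n + 1))
  | bga n =>
    refine hadd (hgab' n) ?_
    simpa [Pth.val, mul_add, add_mul, mul_assoc] using BGA_add_GAB_mem_Kspan (n + (n + 1))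
  | _ n => exact hzero (by simp [Pth.val, mul_assoc])

end T1

section Basis

theorem linearIndependent_and_mem_span_iff {A ι : Type} [Ring A] [Algebra F A] [Fintype ι]
    [DecidableEq ι] {ψ : A →ₗ[F] F} {N : Submodule F A} {p r : ι → A}
    (hpr : ∀ i j, ψ (p i * r j) = if i = j then 1 else 0)
    (hp : ∀ i, ∀ x ∈ N, ψ (p i * x) = 0) (htop : N ⊔ Submodule.span F (Set.range r) = ⊤)
    (hnd : ∀ y, (∀ x, ψ (y * x) = 0) → y = 0) :
    LinearIndependent F p ∧
      ∀ y, y ∈ Submodule.span F (Set.range p) ↔ ∀ x ∈ N, ψ (y * x) = 0 := by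
  have hsum (a : ι → F) (j : ι) : ψ ((∑ i, a i • p i) * r j) = a j := by
    simp [Finset.sum_mul, hpr]
  refine ⟨Fintype.linearIndependent_iff.2 fun a ha j => ?_,
    fun y => ⟨fun hy x hx => ?_, fun hy => ?_⟩⟩
  · rw [← hsum a j, ha, zero_mul, map_zero]
  · have h : Submodule.span F (Set.range p) ≤ LinearMap.ker (ψ ∘ₗ LinearMap.mulRight F x) :=
      Submodule.span_le.2 (Set.range_subset_iff.2 fun i => hp i x hx)
    exact h hy
  · have hy0 : y - ∑ i, ψ (y * r i) • p i = 0 := by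
      refine hnd _ fun x => ?_
      have hle : N ⊔ Submodule.span F (Set.range r) ≤ LinearMap.ker
          (ψ ∘ₗ LinearMap.mulLeft F (y - ∑ i, ψ (y * r i) • p i)) := by
        refine sup_le (fun x hx => ?_) (Submodule.span_le.2 (Set.range_subset_iff.2 fun j => ?_))
        · simp [sub_mul, Finset.sum_mul, hy x hx, hp _ x hx]
        · simp [sub_mul, hsum fun i => ψ (y * r i)]
      exact hle (htop ▸ Submodule.mem_top)
    rw [sub_eq_zero.1 hy0]
    exact Submodule.sum_mem _ fun i _ => Submodule.smul_mem _ _ (Submodule.subset_span ⟨i, rfl⟩)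

/-- The index set of the basis `TP`. -/
abbrev TPIndex : Type :=
  Unit ⊕ Set.Icc (k / 2 + 1) (k - 1) ⊕ Unit ⊕ Set.Icc (s / 2 + 1) s

/-- The elements of `TP`. -/
def TPfamily : TPIndex k s → DA F k s c :=
  Sum.elim (fun _ => η ^ (s / 2) + τ (k / 2) + c • (τ (k - 1) * (β * γ)))
    (Sum.elim (fun i => τ i) (Sum.elim (fun _ => ABG F k s c ^ k) fun j => η ^ (j : ℕ)))

/-- Representatives modulo `T1` dual to `TPfamily`. -/
def TPdual : TPIndex k s → DA F k s c :=
  Sum.elim (fun _ => η ^ (s / 2)) (Sum.elim (fun i => τ (k - i - 1) * (γ * (α * β)))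
    (Sum.elim (fun _ => ε₁) fun j => if (j : ℕ) = s then ε₂ else η ^ (s - j)))

variable {F k s c}

theorem range_TPfamily (hk : 2 ≤ k) (hc : c = 0 ∨ c = 1) :
    Set.range (TPfamily F k s c) = TP F k s c := by
  have hN : Np F k s c = {η ^ (s / 2) + τ (k / 2) + c • (τ (k - 1) * (β * γ))} := by
    have hk2 : k / 2 ≠ 0 := by omega
    rw [← ABG_pow_add_BGA_pow_add_GAB_pow hk2]
    obtain rfl | rfl := hc <;> simp [Np, BGA_pow_mul_Be_mul_Ga, add_assoc]
  have hC : (fun i => ABG F k s c ^ i + BGA F k s c ^ i + GAB F k s c ^ i) ''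
      Set.Icc (k / 2 + 1) (k - 1) = (fun i => τ i) '' Set.Icc (k / 2 + 1) (k - 1) :=
    Set.image_congr fun i hi => ABG_pow_add_BGA_pow_add_GAB_pow (by have := hi.1; omega)
  rw [TP, hN, hC, TPfamily]
  simp only [Set.Sum.elim_range, Set.range_const, Set.image_eq_range, Set.union_assoc]

theorem PathForm.TPfamily_mul_TPdual [CharP F 2] {ψ : DA F k s c →ₗ[F] F}
    (hf : PathForm F k s c ψ) (hk : 2 ≤ k) (hkev : Even k) (hs : 2 ≤ s) (hsev : Even s)
    (i j : TPIndex k s) :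
    ψ (TPfamily F k s c i * TPdual F k s c j) = if i = j then 1 else 0 := by
  obtain ⟨l, hl⟩ := hkev
  obtain ⟨m, hm⟩ := hsev
  have hs2 : s / 2 ≠ 0 := by omega
  have hss : s / 2 + s / 2 = s := by omega
  have hk2 : k / 2 ≠ 0 := by omega
  rcases i with _ | ⟨i, hi⟩ | _ | ⟨i, hi⟩ <;>
  rcases j with _ | ⟨j, hj⟩ | _ | ⟨j, hj⟩ <;>
  simp [TPfamily, TPdual, ABG_pow_card, add_mul, mul_assoc, mul_ite, apply_ite ψ, hf.values,
    Et_pow_mul_Et_pow, cycPow_mul_E1, cycPow_mul_E2, hs2, hk2]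
  · exact hss
  · have := Set.mem_Icc.1 hj
    omega
  · split_ifs <;> first | omega | simp
  · have := Set.mem_Icc.1 hj
    rcases eq_or_ne j s with rfl | h
    · simp [show j / 2 ≠ j by omega, show k / 2 ≠ k by omega, show k / 2 - 1 + 1 ≠ k by omega,
        hf.values, hs2, hk2]
    · have hsj : s - j ≠ 0 := by omega
      simp [h, hsj, hk2, show s / 2 + (s - j) ≠ s by omega, hf.values]
  · have := Set.mem_Icc.1 hi
    simp [show i ≠ 0 by omega, hs2]
  · have := Set.mem_Icc.1 hi
    have := Set.mem_Icc.1 hj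
    split_ifs <;> first | rfl | omega
  · have := Set.mem_Icc.1 hi
    simp [show i ≠ 0 by omega, cycPow_mul_E1, hf.values, CharTwo.add_self_eq_zero]
  · have := Set.mem_Icc.1 hi
    have := Set.mem_Icc.1 hj
    split_ifs
    · simp [show i ≠ 0 by omega, cycPow_mul_E2, hf.values]
      omega
    · simp [show i ≠ 0 by omega, show s - j ≠ 0 by omega]
  · omega
  · have := Set.mem_Icc.1 hj
    intro h
    simp [show s - j ≠ 0 by omega]
  · have := Set.mem_Icc.1 hi
    omega
  · have := Set.mem_Icc.1 hi
    simp [show i ≠ 0 by omega]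
  · have := Set.mem_Icc.1 hi
    simp [show i ≠ 0 by omega]
  · have := Set.mem_Icc.1 hi
    have := Set.mem_Icc.1 hj
    have hi0 : i ≠ 0 := by omega
    split_ifs <;> simp [hi0, hf.values] <;> omega

theorem PathForm.TPfamily_mem_T1perp [CharP F 2] {ψ : DA F k s c →ₗ[F] F}
    (hf : PathForm F k s c ψ) (hk : 2 ≤ k) (hkev : Even k) (hs : 2 ≤ s) (hsev : Even s)
    (hc : c = 0 ∨ c = 1) (i : TPIndex k s) : TPfamily F k s c i ∈ T1perp F k s c ψ := by
  rcases i with _ | ⟨i, hi, hi'⟩ | _ | ⟨i, hi, -⟩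
  · exact hf.middle_mem_T1perp hk hkev hs hsev hc
  · exact hf.cycPow_mem_T1perp (i := i) (by omega) (by omega) hkev
  · exact hf.ABG_pow_mem_T1perp hk
  · exact hf.Et_pow_mem_T1perp (j := i) (by omega) hsev

theorem T1_sup_span_TPdual [CharP F 2] (hk : 2 ≤ k) (hkev : Even k) (hs : 2 ≤ s) (hsev : Even s)
    (hc : c = 0 ∨ c = 1) :
    T1 F k s c ⊔ Submodule.span F (Set.range (TPdual F k s c)) = ⊤ := by
  have hr (i : TPIndex k s) :
      TPdual F k s c i ∈ T1 F k s c ⊔ Submodule.span F (Set.range (TPdual F k s c)) :=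
    Submodule.mem_sup_right (Submodule.subset_span ⟨i, rfl⟩)
  refine eq_top_of_T1_le le_sup_left hk hkev hs hsev hc (hr (.inr (.inr (.inl ())))) ?_
    (fun n hn => ?_) fun n hn => ?_
  · simpa [TPdual] using hr (.inr (.inr (.inr ⟨s, by omega, le_rfl⟩)))
  · obtain h | h := hn.eq_or_lt
    · rw [h]
      exact hr (.inl ())
    · have := hr (.inr (.inr (.inr ⟨s - (n + 1), by omega, by omega⟩)))
      rwa [TPdual, Sum.elim_inr, Sum.elim_inr, Sum.elim_inr, if_neg (by simp; omega),
        show s - (s - (n + 1)) = n + 1 by omega] at this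
  · have := hr (.inr (.inl ⟨k - (n + 1), by omega, by omega⟩))
    rwa [TPdual, Sum.elim_inr, Sum.elim_inl, show k - (k - (n + 1)) - 1 = n by omega] at this

end Basis

end Relations

/-- **Basis of the generalized Reynolds ideal `T₁(A^{k,s}_c)^⊥` (dihedral type,
`k`, `s` both even).** -/
theorem dihedral_T1perp_basis_even_even
    (F : Type) [Field F] [IsAlgClosed F] [CharP F 2]
    (k s : ℕ) (hk : 2 ≤ k) (hkev : Even k) (hs : 2 ≤ s) (hsev : Even s)
    (c : F) (hc : c = 0 ∨ c = 1)
    (ψ : DA F k s c →ₗ[F] F) (hψ : SoclePsi F k s c ψ) :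
    LinearIndependent F (fun p : (TP F k s c) => (p : DA F k s c)) ∧
    (Submodule.span F (TP F k s c) : Set (DA F k s c)) = T1perp F k s c ψ := by
  have : NeZero k := ⟨by omega⟩
  have hf := hψ.pathForm hk hs
  have hT := range_TPfamily (F := F) (s := s) hk hc
  have hmain := linearIndependent_and_mem_span_iff F (N := T1 F k s c) (ψ := ψ)
    (hf.TPfamily_mul_TPdual hk hkev hs hsev)
    (fun i x hx => hf.TPfamily_mem_T1perp hk hkev hs hsev hc i x hx)
    (T1_sup_span_TPdual hk hkev hs hsev hc) (fun y hy => hf.eq_zero_of_forall hk hs hy)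
  refine ⟨hmain.1.linearIndepOn_id' hT, ?_⟩
  ext y
  rw [← hT]
  exact hmain.2 y

end DihedralPaper

end
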